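/- arXiv:1807.10694 — 2 statements merged into one kernel-verified Lean document; each statement's English description precedes it below -/
import Mathlib

section
/- Let ρ_t : L^∞_d(F) → L^∞(F_t) be a scalarized conditional convex 𝕂_t-compatible risk measure. Then ρ_t satisfies: (1) F_t-Lipschitz continuity: |ρ_t(X) − ρ_t(Y)| ≤ ‖X−Y‖_{𝕂_t,t} almost surely for every X,Y ∈ L^∞_d(F), where ‖X‖_{𝕂_t,t} := essinf{ c ∈ L^∞(F_t) : c e_1 − X ∈ 𝕂_t and X + c e_1 ∈ 𝕂_t }; and (2) the local property: 1_B ρ_t(X) = 1_B ρ_t(1_B X) for every X ∈ L^∞_d(F) and B ∈ F_t. -/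
open MeasureTheory Filter Set
open scoped ENNReal

noncomputable section

namespace RiskPaper

variable {Ω : Type*}

/-- Euclidean inner product on `Fin d → ℝ`. -/
def dot {d : ℕ} (x y : Fin d → ℝ) : ℝ := ∑ i, x i * y i

/-- The first unit vector `e₁ = (1,0,…,0) ∈ ℝ^d`. -/
def e1 (d : ℕ) : Fin d → ℝ := fun i => if (i : ℕ) = 0 then 1 else 0

/-- The `i`-th unit vector of `ℝ^d`. -/
def eVec {d : ℕ} (i : Fin d) : Fin d → ℝ := fun j => if j = i then 1 else 0

/-- Measurability with respect to an explicitly given σ-algebra on the domain. -/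
def MeasF {α : Type*} [MeasurableSpace α] (m : MeasurableSpace Ω) (f : Ω → α) : Prop :=
  @Measurable Ω α m _ f

/-- `L^∞_d(F_t)`: bounded `F_t`-measurable `ℝ^d`-valued random variables
(pointwise representatives). -/
def LinfD (F : ℕ → MeasurableSpace Ω) (d t : ℕ) : Set (Ω → Fin d → ℝ) :=
  {X | MeasF (F t) X ∧ ∃ C : ℝ, ∀ ω i, |X ω i| ≤ C}

/-- `L^∞(F_t)`: bounded `F_t`-measurable scalar random variables. -/
def Linf (F : ℕ → MeasurableSpace Ω) (t : ℕ) : Set (Ω → ℝ) :=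
  {x | MeasF (F t) x ∧ ∃ C : ℝ, ∀ ω, |x ω| ≤ C}

/-- The eligible space `M_t = L^∞(F_t) × {0}^{d-1}` (portfolios held in the first asset). -/
def Mt (F : ℕ → MeasurableSpace Ω) (d t : ℕ) : Set (Ω → Fin d → ℝ) :=
  {m | m ∈ LinfD F d t ∧ ∀ ω, ∀ i : Fin d, (i : ℕ) ≠ 0 → m ω i = 0}

/-- The nonnegative elements `M_{t,+}` of `M_t`. -/
def MtPlus (F : ℕ → MeasurableSpace Ω) (d t : ℕ) : Set (Ω → Fin d → ℝ) :=
  {m | m ∈ Mt F d t ∧ ∀ ω i, 0 ≤ m ω i}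

/-- Structural assumptions on the filtration `(F_t)_{t=0}^T`: increasing, contained in the
ambient σ-algebra, `F_T` equal to the ambient σ-algebra, and `F_0` `P`-trivial. -/
def FiltrationOK [m0 : MeasurableSpace Ω] (F : ℕ → MeasurableSpace Ω) (P : Measure Ω)
    (T : ℕ) : Prop :=
  (∀ s t : ℕ, s ≤ t → F s ≤ F t) ∧ (∀ t, F t ≤ m0) ∧ F T = m0 ∧
    ∀ A : Set Ω, MeasurableSet[F 0] A → P A = 0 ∨ P A = 1

section Meas
variable [MeasurableSpace Ω]

/-- `g` is (a version of) the essential infimum of the set `A` of random variables. -/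
def IsEssInfSet (P : Measure Ω) (A : Set (Ω → ℝ)) (g : Ω → ℝ) : Prop :=
  (∀ f ∈ A, ∀ᵐ ω ∂P, g ω ≤ f ω) ∧
    ∀ h : Ω → ℝ, (∀ f ∈ A, ∀ᵐ ω ∂P, h ω ≤ f ω) → ∀ᵐ ω ∂P, h ω ≤ g ω

/-- `g` is (a version of) the essential supremum of the set `A` of random variables. -/
def IsEssSupSet (P : Measure Ω) (A : Set (Ω → ℝ)) (g : Ω → ℝ) : Prop :=
  (∀ f ∈ A, ∀ᵐ ω ∂P, f ω ≤ g ω) ∧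
    ∀ h : Ω → ℝ, (∀ f ∈ A, ∀ᵐ ω ∂P, f ω ≤ h ω) → ∀ᵐ ω ∂P, g ω ≤ h ω

/-- Essential supremum of a set of extended-real-valued random variables
(to accommodate the values `±∞`). -/
def IsEssSupSetE (P : Measure Ω) (A : Set (Ω → EReal)) (g : Ω → EReal) : Prop :=
  (∀ f ∈ A, ∀ᵐ ω ∂P, f ω ≤ g ω) ∧
    ∀ h : Ω → EReal, (∀ f ∈ A, ∀ᵐ ω ∂P, f ω ≤ h ω) → ∀ᵐ ω ∂P, g ω ≤ h ω

/-- Essential infimum of a set of extended-real-valued random variables. -/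
def IsEssInfSetE (P : Measure Ω) (A : Set (Ω → EReal)) (g : Ω → EReal) : Prop :=
  (∀ f ∈ A, ∀ᵐ ω ∂P, g ω ≤ f ω) ∧
    ∀ h : Ω → EReal, (∀ f ∈ A, ∀ᵐ ω ∂P, h ω ≤ f ω) → ∀ᵐ ω ∂P, h ω ≤ g ω

/-- An (extended-real-valued) random variable lies in `L^∞(F_t)`:
it agrees `P`-a.s. with a bounded `F_t`-measurable real random variable. -/
def MemLinfE (F : ℕ → MeasurableSpace Ω) (P : Measure Ω) (t : ℕ) (g : Ω → EReal) : Prop :=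
  ∃ x ∈ Linf F t, g =ᵐ[P] fun ω => (x ω : EReal)

/-- The Radon–Nikodym density `dQ/dP` as a real random variable. -/
def rnd (P Q : Measure Ω) : Ω → ℝ := fun ω => (Q.rnDeriv P ω).toReal

/-- `ξ̄_{t,T}(Q) = (dQ/dP)/E[dQ/dP | F_t]` on `{E[dQ/dP|F_t] > 0}` and `1` elsewhere. -/
def xiBar (F : ℕ → MeasurableSpace Ω) (P Q : Measure Ω) (t : ℕ) : Ω → ℝ := fun ω =>
  if 0 < (P[rnd P Q | F t]) ω then rnd P Q ω / (P[rnd P Q | F t]) ω else 1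

/-- The `P`-a.s. version of the conditional expectation `E^Q[x | F_t]`, defined as
`E[ξ̄_{t,T}(Q) x | F_t]`. -/
def EQcond (F : ℕ → MeasurableSpace Ω) (P Q : Measure Ω) (t : ℕ) (x : Ω → ℝ) : Ω → ℝ :=
  P[fun ω => xiBar F P Q t ω * x ω | F t]

end Meas

/-- The solvency regions are closed convex cones (pointwise in `ω`). -/
def ConesOK {d : ℕ} (K : ℕ → Ω → Set (Fin d → ℝ)) : Prop :=
  ∀ s (ω : Ω), IsClosed (K s ω) ∧ Convex ℝ (K s ω) ∧
    (0 : Fin d → ℝ) ∈ K s ω ∧ ∀ c : ℝ, 0 ≤ c → ∀ x ∈ K s ω, c • x ∈ K s ω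

/-- The trading set `𝕂_t = Σ_{s=t}^T L^∞_d(F_s; K_s)`. -/
def KK (F : ℕ → MeasurableSpace Ω) (d T : ℕ) (K : ℕ → Ω → Set (Fin d → ℝ)) (t : ℕ) :
    Set (Ω → Fin d → ℝ) :=
  {X | ∃ k : ℕ → Ω → Fin d → ℝ,
      (∀ s, t ≤ s → s ≤ T → k s ∈ LinfD F d s ∧ ∀ ω, k s ω ∈ K s ω) ∧
      ∀ ω, X ω = ∑ s ∈ Finset.Icc t T, k s ω}

/-- Assumption 2.2 of the paper: `K_T ⊇ K̄` a.s. for a convex cone `K̄` with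
`int K̄ ⊇ ℝ^d_+ \ {0}`. -/
def FrictionAssumption [MeasurableSpace Ω] (P : Measure Ω) {d : ℕ} (T : ℕ)
    (K : ℕ → Ω → Set (Fin d → ℝ)) : Prop :=
  ∃ Kbar : Set (Fin d → ℝ), Convex ℝ Kbar ∧
    (∀ c : ℝ, 0 ≤ c → ∀ x ∈ Kbar, c • x ∈ Kbar) ∧
    {x : Fin d → ℝ | (∀ i, 0 ≤ x i) ∧ x ≠ 0} ⊆ interior Kbar ∧
    ∀ᵐ ω ∂P, Kbar ⊆ K T ω

/-- The norm `‖x‖_{𝕂_T,0}` for a deterministic portfolio `x ∈ ℝ^d`: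
`inf{c ∈ ℝ : c e₁ − x ∈ 𝕂_T, x + c e₁ ∈ 𝕂_T}`. -/
def normKT0 (F : ℕ → MeasurableSpace Ω) (d T : ℕ) (K : ℕ → Ω → Set (Fin d → ℝ))
    (x : Fin d → ℝ) : ℝ :=
  sInf {c : ℝ | (fun (_ : Ω) i => c * e1 d i - x i) ∈ KK F d T K T ∧
      (fun (_ : Ω) i => x i + c * e1 d i) ∈ KK F d T K T}

/-- The positive dual cone of a set `C ⊆ ℝ^d`. -/
def dualCone {d : ℕ} (C : Set (Fin d → ℝ)) : Set (Fin d → ℝ) := {y | ∀ x ∈ C, 0 ≤ dot x y}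

section MeasP
variable [MeasurableSpace Ω]

/-- The positive dual cone `𝕂_t^+ ⊆ L^1_d` of the trading set `𝕂_t`. -/
def KKplus (F : ℕ → MeasurableSpace Ω) (P : Measure Ω) (d T : ℕ)
    (K : ℕ → Ω → Set (Fin d → ℝ)) (t : ℕ) : Set (Ω → Fin d → ℝ) :=
  {v | (∀ i : Fin d, Integrable (fun ω => v ω i) P) ∧
      ∀ u ∈ KK F d T K t, 0 ≤ ∫ ω, dot (v ω) (u ω) ∂P}

/-- `(Q,S) ∈ 𝒬_t`: `Q ≪ P` a probability measure and `(S_s)_{s=t}^T` a consistent pricing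
process with `S_{s,1} ≡ 1`, the `L^∞` bound `‖S_{s,i}‖_∞ ≤ max{‖e_i‖_{𝕂_T,0},1}`,
`S_s = E^Q[S_T | F_s]` and `(dQ/dP) S_T ∈ 𝕂_t^+`. -/
def memQt (F : ℕ → MeasurableSpace Ω) (P : Measure Ω) (d T : ℕ)
    (K : ℕ → Ω → Set (Fin d → ℝ)) (t : ℕ) (Q : Measure Ω) (S : ℕ → Ω → Fin d → ℝ) : Prop :=
  IsProbabilityMeasure Q ∧ Q ≪ P ∧
    (∀ s, t ≤ s → s ≤ T →
      S s ∈ LinfD F d s ∧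
      (∀ ω, ∀ i : Fin d, (i : ℕ) = 0 → S s ω i = 1) ∧
      (∀ i : Fin d, ∀ ω, |S s ω i| ≤ max (normKT0 F d T K (eVec i)) 1) ∧
      ∀ i : Fin d, (fun ω => S s ω i) =ᵐ[P] EQcond F P Q s fun ω => S T ω i) ∧
    (fun ω i => rnd P Q ω * S T ω i) ∈ KKplus F P d T K t

/-- `(Q,S) ∈ 𝒬_t^e`: additionally `Q` is equivalent to `P`. -/
def memQtE (F : ℕ → MeasurableSpace Ω) (P : Measure Ω) (d T : ℕ)
    (K : ℕ → Ω → Set (Fin d → ℝ)) (t : ℕ) (Q : Measure Ω) (S : ℕ → Ω → Fin d → ℝ) : Prop :=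
  memQt F P d T K t Q S ∧ P ≪ Q

/-- The set `𝒮` of eligible (frictionless) pricing processes. -/
def memS (F : ℕ → MeasurableSpace Ω) (d T : ℕ) (K : ℕ → Ω → Set (Fin d → ℝ))
    (S : ℕ → Ω → Fin d → ℝ) : Prop :=
  ∀ t ≤ T, S t ∈ LinfD F d t ∧ (∀ ω, S t ω ∈ dualCone (K t ω)) ∧
    (∀ ω, ∀ i : Fin d, (i : ℕ) = 0 → S t ω i = 1) ∧
    ∀ i : Fin d, ∀ ω, |S t ω i| ≤ max (normKT0 F d T K (eVec i)) 1

/-- `Q ∈ 𝒬^e(S)`: `Q` is a probability measure equivalent to `P` under which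
`S` is a martingale (with the `P`-a.s. version of conditional expectations). -/
def QeS (F : ℕ → MeasurableSpace Ω) (P : Measure Ω) (d T : ℕ)
    (S : ℕ → Ω → Fin d → ℝ) : Set (Measure Ω) :=
  {Q | IsProbabilityMeasure Q ∧ Q ≪ P ∧ P ≪ Q ∧
    ∀ s ≤ T, ∀ i : Fin d, (fun ω => S s ω i) =ᵐ[P] EQcond F P Q s fun ω => S T ω i}

/-- The cone `Γ_t(S_t) = {Z ∈ L^∞_d(F_t) : S_t^⊤ Z ≥ 0 a.s.}`. -/
def Gamma (F : ℕ → MeasurableSpace Ω) (P : Measure Ω) (d : ℕ)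
    (S : ℕ → Ω → Fin d → ℝ) (t : ℕ) : Set (Ω → Fin d → ℝ) :=
  {Z | Z ∈ LinfD F d t ∧ ∀ᵐ ω ∂P, 0 ≤ dot (S t ω) (Z ω)}

/-- The set `Σ_{s=0}^T Γ_s(S_s)` of claims attainable from zero. -/
def SumGamma (F : ℕ → MeasurableSpace Ω) (P : Measure Ω) (d T : ℕ)
    (S : ℕ → Ω → Fin d → ℝ) : Set (Ω → Fin d → ℝ) :=
  {X | ∃ Z : ℕ → Ω → Fin d → ℝ, (∀ s ≤ T, Z s ∈ Gamma F P d S s) ∧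
      ∀ ω, X ω = ∑ s ∈ Finset.range (T + 1), Z s ω}

/-- The no-arbitrage condition (NA):
`[Σ_{s=0}^T Γ_s(S_s)] ∩ [−Γ_T(S_T)] ⊆ Γ_T(S_T)`. -/
def NoArb (F : ℕ → MeasurableSpace Ω) (P : Measure Ω) (d T : ℕ)
    (S : ℕ → Ω → Fin d → ℝ) : Prop :=
  ∀ X ∈ SumGamma F P d T S, (fun ω => -X ω) ∈ Gamma F P d S T → X ∈ Gamma F P d S T

/-- `ρ_t` is a scalarized conditional convex risk measure: finite (`L^∞(F_t)`-valued),
conditionally cash invariant in the first asset, monotone, conditionally convex. -/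
structure ScalarRM (F : ℕ → MeasurableSpace Ω) (P : Measure Ω) (d T t : ℕ)
    (rho : (Ω → Fin d → ℝ) → Ω → ℝ) : Prop where
  finite : ∀ X ∈ LinfD F d T, ∃ g ∈ Linf F t, rho X =ᵐ[P] g
  cash : ∀ X ∈ LinfD F d T, ∀ m ∈ Linf F t,
    rho (fun ω => X ω + m ω • e1 d) =ᵐ[P] fun ω => rho X ω - m ω
  mono : ∀ X ∈ LinfD F d T, ∀ Y ∈ LinfD F d T,
    (∀ ω i, X ω i ≤ Y ω i) → rho Y ≤ᵐ[P] rho X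
  convex : ∀ X ∈ LinfD F d T, ∀ Y ∈ LinfD F d T, ∀ lam ∈ Linf F t,
    (∀ ω, lam ω ∈ Set.Icc (0 : ℝ) 1) →
    rho (fun ω => lam ω • X ω + (1 - lam ω) • Y ω) ≤ᵐ[P]
      fun ω => lam ω * rho X ω + (1 - lam ω) * rho Y ω

/-- Conditional positive homogeneity (coherence). -/
def CoherentRM (F : ℕ → MeasurableSpace Ω) (P : Measure Ω) (d T t : ℕ)
    (rho : (Ω → Fin d → ℝ) → Ω → ℝ) : Prop :=
  ∀ X ∈ LinfD F d T, ∀ lam ∈ Linf F t, (∀ ω, 0 ≤ lam ω) →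
    rho (fun ω => lam ω • X ω) =ᵐ[P] fun ω => lam ω * rho X ω

/-- `𝕂_t`-compatibility of a scalar risk measure:
`ρ_t(X) = essinf_{k ∈ 𝕂_t} ρ_t(X−k)`. -/
def KCompat (F : ℕ → MeasurableSpace Ω) (P : Measure Ω) (d T : ℕ)
    (K : ℕ → Ω → Set (Fin d → ℝ)) (t : ℕ) (rho : (Ω → Fin d → ℝ) → Ω → ℝ) : Prop :=
  ∀ X ∈ LinfD F d T,
    IsEssInfSet P {g | ∃ k ∈ KK F d T K t, g = rho fun ω => X ω - k ω} (rho X)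

/-- The acceptance set `A_t = {X ∈ L^∞_d(F) : ρ_t(X) ≤ 0}`. -/
def Acc (F : ℕ → MeasurableSpace Ω) (P : Measure Ω) (d T : ℕ)
    (rho : (Ω → Fin d → ℝ) → Ω → ℝ) : Set (Ω → Fin d → ℝ) :=
  {X | X ∈ LinfD F d T ∧ ∀ᵐ ω ∂P, rho X ω ≤ 0}

/-- `β` is (a version of) the penalty function
`β_t(Q,S) = esssup_{Z ∈ A} −E^Q[S_T^⊤ Z | F_t]`. -/
def IsPenalty (F : ℕ → MeasurableSpace Ω) (P : Measure Ω) (d T t : ℕ)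
    (A : Set (Ω → Fin d → ℝ)) (Q : Measure Ω) (S : ℕ → Ω → Fin d → ℝ)
    (beta : Ω → EReal) : Prop :=
  IsEssSupSetE P
    {g | ∃ Z ∈ A, g = fun ω =>
      ((-(EQcond F P Q t (fun ω' => dot (S T ω') (Z ω')) ω) : ℝ) : EReal)} beta

/-- `g` is (a version of) `π_t^S(X) = esssup_{Q ∈ 𝒬^e(S)} (−β_t(Q,S) − E^Q[S_T^⊤ X|F_t])`. -/
def IsPi (F : ℕ → MeasurableSpace Ω) (P : Measure Ω) (d T t : ℕ)
    (beta : Measure Ω → Ω → EReal) (S : ℕ → Ω → Fin d → ℝ) (X : Ω → Fin d → ℝ)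
    (g : Ω → EReal) : Prop :=
  IsEssSupSetE P
    {h | ∃ Q ∈ QeS F P d T S, h = fun ω =>
      -beta Q ω - ((EQcond F P Q t (fun ω' => dot (S T ω') (X ω')) ω : ℝ) : EReal)} g

/-- The Fatou property of `ρ_t`. -/
def Fatou (F : ℕ → MeasurableSpace Ω) (P : Measure Ω) (d T : ℕ)
    (rho : (Ω → Fin d → ℝ) → Ω → ℝ) : Prop :=
  ∀ X ∈ LinfD F d T, ∀ Xn : ℕ → Ω → Fin d → ℝ, (∀ n, Xn n ∈ LinfD F d T) →
    (∃ C : ℝ, ∀ n ω i, |Xn n ω i| ≤ C) →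
    (∀ᵐ ω ∂P, Tendsto (fun n => Xn n ω) atTop (nhds (X ω))) →
    ∀ᵐ ω ∂P, rho X ω ≤ atTop.liminf fun n => rho (Xn n) ω

/-- Relevance (sensitivity): `P(ρ_t(−ε 1_D e₁) > ρ_t(0)) > 0` for all `ε > 0` and all
`D ∈ F` with positive probability. -/
def Relevant (P : Measure Ω) (d : ℕ) (rho : (Ω → Fin d → ℝ) → Ω → ℝ) : Prop :=
  ∀ ε : ℝ, 0 < ε → ∀ D : Set Ω, MeasurableSet D → 0 < P D →
    0 < P {ω | rho (fun _ _ => 0) ω <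
      rho (fun ω' => (-(ε * D.indicator (fun _ => (1 : ℝ)) ω')) • e1 d) ω}

end MeasP
section LocalProperty

/-- Shifting a position by an earlier-measurable amount of the first asset stays in `L^∞_d`. -/
theorem LinfD.add_smul_e1 {F : ℕ → MeasurableSpace Ω} {d s t : ℕ} (hst : F s ≤ F t)
    {X : Ω → Fin d → ℝ} (hX : X ∈ LinfD F d t) {c : Ω → ℝ} (hc : c ∈ Linf F s) :
    (fun ω => X ω + c ω • e1 d) ∈ LinfD F d t := by
  obtain ⟨hXm, C, hC⟩ := hX
  obtain ⟨hcm, D, hD⟩ := hc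
  have hcm' : @Measurable Ω ℝ (F t) _ c := Measurable.mono hcm hst le_rfl
  refine ⟨?_, C + D, fun ω i => ?_⟩
  · have hXm' : @Measurable Ω _ (F t) _ X := hXm
    exact hXm'.add (hcm'.smul_const (e1 d))
  · have he : |e1 d i| ≤ 1 := by
      unfold e1
      split_ifs <;> simp
    calc |(X ω + c ω • e1 d) i| ≤ |X ω i| + |c ω * e1 d i| := abs_add_le _ _
      _ ≤ C + D := by
        refine add_le_add (hC ω i) ?_
        rw [abs_mul]
        exact (mul_le_of_le_one_right (abs_nonneg _) he).trans (hD ω)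

theorem LinfD.sub {F : ℕ → MeasurableSpace Ω} {d t : ℕ} {X Y : Ω → Fin d → ℝ}
    (hX : X ∈ LinfD F d t) (hY : Y ∈ LinfD F d t) : (fun ω => X ω - Y ω) ∈ LinfD F d t := by
  obtain ⟨hXm, C, hC⟩ := hX
  obtain ⟨hYm, D, hD⟩ := hY
  have hXm' : @Measurable Ω _ (F t) _ X := hXm
  have hYm' : @Measurable Ω _ (F t) _ Y := hYm
  refine ⟨hXm'.sub hYm', C + D, fun ω i => ?_⟩
  exact (abs_sub _ _).trans (add_le_add (hC ω i) (hD ω i))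

theorem LinfD.indicator {F : ℕ → MeasurableSpace Ω} {d t : ℕ} {X : Ω → Fin d → ℝ}
    (hX : X ∈ LinfD F d t) {B : Set Ω} (hB : MeasurableSet[F t] B) :
    B.indicator X ∈ LinfD F d t := by
  obtain ⟨hXm, C, hC⟩ := hX
  have hXm' : @Measurable Ω _ (F t) _ X := hXm
  refine ⟨hXm'.indicator hB, C, fun ω i => ?_⟩
  by_cases h : ω ∈ B
  · simpa [h] using hC ω i
  · simpa [h] using (abs_nonneg _).trans (hC ω i)

variable [MeasurableSpace Ω]

/-- On `B ∈ F_t`, pasting `X` on `B` with `Y` off `B` does not increase the risk of `X`. -/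
theorem ScalarRM.le_of_eqOn {F : ℕ → MeasurableSpace Ω} {P : Measure Ω} {d T t : ℕ}
    {rho : (Ω → Fin d → ℝ) → Ω → ℝ} (hrho : ScalarRM F P d T t rho)
    {X Y Z : Ω → Fin d → ℝ} (hX : X ∈ LinfD F d T) (hY : Y ∈ LinfD F d T) {B : Set Ω}
    (hB : MeasurableSet[F t] B) (hZX : ∀ ω ∈ B, Z ω = X ω) (hZY : ∀ ω ∉ B, Z ω = Y ω) :
    ∀ᵐ ω ∂P, ω ∈ B → rho Z ω ≤ rho X ω := by
  have hlam : B.indicator (fun _ => (1 : ℝ)) ∈ Linf F t := by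
    have h1 : @Measurable Ω ℝ (F t) _ fun _ => 1 := measurable_const
    refine ⟨h1.indicator hB, 1, fun ω => ?_⟩
    by_cases h : ω ∈ B <;> simp [h]
  have hconv := hrho.convex X hX Y hY _ hlam fun ω => by
    by_cases h : ω ∈ B <;> simp [h]
  have hZ : (fun ω => B.indicator (fun _ => (1 : ℝ)) ω • X ω +
      (1 - B.indicator (fun _ => (1 : ℝ)) ω) • Y ω) = Z := by
    funext ω
    by_cases h : ω ∈ B
    · simp [h, hZX ω h]
    · simp [h, hZY ω h]
  rw [hZ] at hconv
  filter_upwards [hconv] with ω hω h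
  simpa [h] using hω

/-- If `Y + c e₁ - X` can be traded from zero, then `ρ(Y) - ρ(X) ≤ c`. -/
theorem ScalarRM.sub_le_of_mem_KK {F : ℕ → MeasurableSpace Ω} {P : Measure Ω} {d T t : ℕ}
    {K : ℕ → Ω → Set (Fin d → ℝ)} {rho : (Ω → Fin d → ℝ) → Ω → ℝ} (hF : F t ≤ F T)
    (hrho : ScalarRM F P d T t rho) (hK : KCompat F P d T K t rho)
    {X Y : Ω → Fin d → ℝ} (hY : Y ∈ LinfD F d T) {c : Ω → ℝ} (hc : c ∈ Linf F t)
    (hk : (fun ω => Y ω + c ω • e1 d - X ω) ∈ KK F d T K t) :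
    ∀ᵐ ω ∂P, rho Y ω - rho X ω ≤ c ω := by
  have hle := (hK _ (LinfD.add_smul_e1 hF hY hc)).1 _ ⟨_, hk, rfl⟩
  simp only [sub_sub_cancel] at hle
  filter_upwards [hle, hrho.cash Y hY c hc] with ω h1 h2
  linarith

end LocalProperty

/-- Proposition 3.4.  A scalarized conditional convex `𝕂_t`-compatible risk
measure satisfies `F_t`-Lipschitz continuity, `|ρ_t(X) − ρ_t(Y)| ≤ ‖X−Y‖_{𝕂_t,t}` a.s.,
where `‖X‖_{𝕂_t,t} = essinf{c ∈ L^∞(F_t) : c e₁ − X ∈ 𝕂_t, X + c e₁ ∈ 𝕂_t}`,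
and the local property `1_B ρ_t(X) = 1_B ρ_t(1_B X)` for all `B ∈ F_t`. -/
theorem statement1 [MeasurableSpace Ω] (F : ℕ → MeasurableSpace Ω) (P : Measure Ω)
    [IsProbabilityMeasure P] (d T t : ℕ) (ht : t ≤ T) (K : ℕ → Ω → Set (Fin d → ℝ))
    (hFil : FiltrationOK F P T) (hK : ConesOK K) (hKbar : FrictionAssumption P T K)
    (rho : (Ω → Fin d → ℝ) → Ω → ℝ)
    (hrho : ScalarRM F P d T t rho) (hKcomp : KCompat F P d T K t rho)
    -- `N X` is a version of the norm `‖X‖_{𝕂_t,t}`: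
    (N : (Ω → Fin d → ℝ) → Ω → ℝ)
    (hN : ∀ X ∈ LinfD F d T,
      IsEssInfSet P {c | c ∈ Linf F t ∧ (fun ω => c ω • e1 d - X ω) ∈ KK F d T K t ∧
        (fun ω => X ω + c ω • e1 d) ∈ KK F d T K t} (N X)) :
    -- (1) `F_t`-Lipschitz continuity:
    (∀ X ∈ LinfD F d T, ∀ Y ∈ LinfD F d T,
      ∀ᵐ ω ∂P, |rho X ω - rho Y ω| ≤ N (fun ω' => X ω' - Y ω') ω) ∧
    -- (2) the local property:
    (∀ X ∈ LinfD F d T, ∀ B : Set Ω, MeasurableSet[F t] B →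
      ∀ᵐ ω ∂P, B.indicator (rho X) ω = B.indicator (rho (B.indicator X)) ω) := by
  have hF : F t ≤ F T := hFil.1 t T ht
  refine ⟨fun X hX Y hY => ?_, fun X hX B hB => ?_⟩
  · refine (hN _ (LinfD.sub hX hY)).2 (fun ω => |rho X ω - rho Y ω|) ?_
    rintro c ⟨hc, h1, h2⟩
    have hYX := hrho.sub_le_of_mem_KK hF hKcomp (X := X) hY hc (by
      convert h1 using 2
      abel)
    have hXY := hrho.sub_le_of_mem_KK hF hKcomp (X := Y) hX hc (by
      convert h2 using 2
      abel)
    filter_upwards [hYX, hXY] with ω h1 h2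
    exact abs_le.2 ⟨by linarith, h2⟩
  · have hBX : B.indicator X ∈ LinfD F d T := LinfD.indicator hX (hF B hB)
    have h0 : (fun _ => 0) ∈ LinfD F d T := by
      simpa using LinfD.sub hX hX
    have hle := hrho.le_of_eqOn (Z := B.indicator X) hX h0 hB
      (fun ω h => by simp [h]) (fun ω h => by simp [h])
    have hge := hrho.le_of_eqOn (Z := X) hBX hX hB
      (fun ω h => by simp [h]) (fun ω _ => rfl)
    filter_upwards [hle, hge] with ω h1 h2
    by_cases h : ω ∈ B
    · simpa [h] using le_antisymm (h2 h) (h1 h)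
    · simp [h]

end RiskPaper
end
end

section
/- Let ρ_t be a scalarized conditional convex risk measure (arising from a 𝕂_t-compatible set-valued risk measure). Then ρ_t satisfies the Fatou property if and only if for every X ∈ L^∞_d(F): ρ_t(X) = esssup_{(Q,m_⊥) ∈ W_t(e_1)} ( −α_t(Q,m_⊥) − (e_1+m_⊥)^T E^Q[X|F_t] ), where α_t(Q,m_⊥) := esssup_{Z ∈ A_t} (e_1+m_⊥)^T E^Q[−Z|F_t]. If ρ_t is additionally coherent, this reduces to ρ_t(X) = esssup_{(Q,m_⊥) ∈ W_t^ρ(e_1)} −(e_1+m_⊥)^T E^Q[X|F_t] with W_t^ρ(e_1) := { (Q,m_⊥) ∈ W_t(e_1) : α_t(Q,m_⊥) = 0 P-a.s. }. -/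
open MeasureTheory Filter Set
open scoped ENNReal

noncomputable section

namespace RiskPaper

variable {Ω : Type*}

/-- `(Q, m_⊥) ∈ 𝒲_t(e₁)`: `Q` a vector of probability measures `≪ P`, `m_⊥ ∈ {0} × L^1(F_t; ℝ^{d−1}_+)`,
`(Q, e₁ + m_⊥) ∈ 𝒲_t` (so `w := e₁ + m_⊥ ∈ M_{t,+}^+ \ M_t^⊥` and
`w_t^T(Q, e₁+m_⊥) ∈ L^1_d(ℝ^d_+)`), and `w_t^T(Q, e₁+m_⊥) ∈ 𝕂_t^+`. -/
def memWte1 [MeasurableSpace Ω] (F : ℕ → MeasurableSpace Ω) (P : Measure Ω) (d T : ℕ)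
    (K : ℕ → Ω → Set (Fin d → ℝ)) (t : ℕ) (Qv : Fin d → Measure Ω)
    (mp : Ω → Fin d → ℝ) : Prop :=
  (∀ i : Fin d, IsProbabilityMeasure (Qv i) ∧ Qv i ≪ P) ∧
  (∀ ω, ∀ i : Fin d, (i : ℕ) = 0 → mp ω i = 0) ∧
  (∀ i : Fin d, MeasF (F t) (fun ω => mp ω i) ∧ Integrable (fun ω => mp ω i) P ∧
    ∀ ω, 0 ≤ mp ω i) ∧
  (∀ u ∈ MtPlus F d t, 0 ≤ ∫ ω, dot (fun i => e1 d i + mp ω i) (u ω) ∂P) ∧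
  ¬(∀ u ∈ Mt F d t, ∫ ω, dot (fun i => e1 d i + mp ω i) (u ω) ∂P = 0) ∧
  (∀ i : Fin d, Integrable (fun ω => (e1 d i + mp ω i) * xiBar F P (Qv i) t ω) P ∧
    ∀ ω, 0 ≤ (e1 d i + mp ω i) * xiBar F P (Qv i) t ω) ∧
  (fun ω i => (e1 d i + mp ω i) * xiBar F P (Qv i) t ω) ∈ KKplus F P d T K t

open scoped Pointwise in
/-- Algebraic Hahn–Banach separation of a convex absorbing set from a disjoint convex set. -/
theorem exists_linear_separation {E : Type*} [AddCommGroup E] [Module ℝ E] {W C : Set E}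
    (hW : Convex ℝ W) (hWa : Absorbent ℝ W) (hC : Convex ℝ C) (hCn : C.Nonempty)
    (hd : Disjoint W C) :
    ∃ f : E →ₗ[ℝ] ℝ, (∀ w ∈ W, f w ≤ 1) ∧ ∃ δ : ℝ, 0 < δ ∧ ∀ c ∈ C, δ ≤ f c := by
  obtain ⟨c₀, hc₀⟩ := hCn
  have h0W : (0 : E) ∈ W := hWa.zero_mem
  set S : Set E := (fun x => c₀ + x) '' (W - C) with hS
  have hSconv : Convex ℝ S := (hW.sub hC).translate c₀
  have hWS : W ⊆ S := fun w hw => ⟨w - c₀, ⟨w, hw, c₀, hc₀, rfl⟩, by simp⟩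
  have hSa : Absorbent ℝ S := hWa.mono hWS
  have h0S : (0 : E) ∈ S := hWS h0W
  have hc₀S : c₀ ∉ S := by
    rintro ⟨x, ⟨w, hw, c, hc, rfl⟩, hx⟩
    have : w = c := by
      have : w - c = 0 := by simpa using hx
      exact sub_eq_zero.1 this
    subst this
    exact (Set.disjoint_left.1 hd hw) hc
  have hc₀0 : c₀ ≠ 0 := fun h => hc₀S (h ▸ h0S)
  let f : E →ₗ.[ℝ] ℝ := LinearPMap.mkSpanSingleton c₀ 1 hc₀0
  obtain ⟨φ, hφ₁, hφ₂⟩ := exists_extension_of_le_sublinear f (gauge S)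
    (fun c hc => gauge_smul_of_nonneg hc.le) (gauge_add_le hSconv hSa) (by
      rintro ⟨x, hx⟩
      obtain ⟨y, rfl⟩ := Submodule.mem_span_singleton.1 hx
      rw [LinearPMap.mkSpanSingleton'_apply]
      simp only [mul_one, smul_eq_mul]
      obtain h | h := le_or_gt y 0
      · exact h.trans (gauge_nonneg _)
      · rw [gauge_smul_of_nonneg h.le, smul_eq_mul, RingHom.id_apply,
          le_mul_iff_one_le_right h]
        exact one_le_gauge_of_notMem (hSconv.starConvex h0S) hSa.absorbs hc₀S)
  have hφc : φ c₀ = 1 :=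
    (hφ₁ ⟨c₀, Submodule.mem_span_singleton_self _⟩).trans
      (LinearPMap.mkSpanSingleton'_apply_self _ _ _ _)
  have hφS : ∀ x ∈ S, φ x ≤ 1 := fun x hx => (hφ₂ x).trans (gauge_le_one_of_mem hx)
  have hle : ∀ w ∈ W, ∀ c ∈ C, φ w ≤ φ c := fun w hw c hc => by
    have := hφS (c₀ + (w - c)) ⟨_, ⟨w, hw, c, hc, rfl⟩, rfl⟩
    rw [map_add, map_sub, hφc] at this
    linarith
  refine ⟨φ, fun w hw => hφc ▸ hle w hw c₀ hc₀, ?_⟩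
  obtain ⟨r, hr, hrW⟩ := hWa.gauge_set_nonempty (x := c₀)
  obtain ⟨w, hw, hwc⟩ := hrW
  refine ⟨r⁻¹, inv_pos.2 hr, fun c hc => ?_⟩
  have h1 : φ w = r⁻¹ := by
    have : w = r⁻¹ • c₀ := by rw [← hwc]; simp [smul_smul, inv_mul_cancel₀ hr.ne']
    rw [this, map_smul, hφc, smul_eq_mul, mul_one]
  exact h1 ▸ hle w hw c hc

/-- A decreasing sequence of nonempty convex bounded sets in a Hilbert space admits a convergent
sequence of selections. -/
theorem exists_tendsto_of_antitone_convex {H : Type*} [NormedAddCommGroup H]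
    [InnerProductSpace ℝ H] [CompleteSpace H] (K : ℕ → Set H) (hK : Antitone K)
    (hconv : ∀ n, Convex ℝ (K n)) (hne : ∀ n, (K n).Nonempty) {R : ℝ}
    (hR : ∀ n, ∀ x ∈ K n, ‖x‖ ≤ R) :
    ∃ x : ℕ → H, (∀ n, x n ∈ K n) ∧ ∃ z, Tendsto x atTop (nhds z) := by
  set a : ℕ → ℝ := fun n => sInf ((fun x : H => ‖x‖ ^ 2) '' K n) with ha
  have hbdd : ∀ n, BddBelow ((fun x : H => ‖x‖ ^ 2) '' K n) := fun n =>
    ⟨0, by rintro _ ⟨x, -, rfl⟩; positivity⟩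
  have hale : ∀ n, ∀ x ∈ K n, a n ≤ ‖x‖ ^ 2 := fun n x hx => csInf_le (hbdd n) ⟨x, hx, rfl⟩
  have hamono : Monotone a := fun m n hmn =>
    csInf_le_csInf (hbdd m) ((hne n).image _) (image_mono (hK hmn))
  have haR : ∀ n, a n ≤ R ^ 2 := fun n => by
    obtain ⟨x, hx⟩ := hne n
    exact (hale n x hx).trans (pow_le_pow_left₀ (norm_nonneg _) (hR n x hx) 2)
  have hex : ∀ n : ℕ, ∃ x ∈ K n, ‖x‖ ^ 2 < a n + 1 / ((n : ℝ) + 1) := fun n => by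
    obtain ⟨_, ⟨x, hx, rfl⟩, hlt⟩ := exists_lt_of_csInf_lt ((hne n).image fun x : H => ‖x‖ ^ 2)
      (lt_add_of_pos_right (a n) (Nat.one_div_pos_of_nat (n := n) (α := ℝ)))
    exact ⟨x, hx, hlt⟩
  choose x hxK hx using hex
  refine ⟨x, hxK, cauchySeq_tendsto_of_complete ?_⟩
  have halim : Tendsto a atTop (nhds (⨆ n, a n)) :=
    tendsto_atTop_ciSup hamono ⟨R ^ 2, by rintro _ ⟨n, rfl⟩; exact haR n⟩
  set A := ⨆ n, a n
  have haA : ∀ n, a n ≤ A := fun n =>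
    le_ciSup (f := a) ⟨R ^ 2, by rintro _ ⟨n, rfl⟩; exact haR n⟩ n
  have key : ∀ n m, n ≤ m →
      ‖x n - x m‖ ^ 2 ≤ 4 * (A - a n) + 4 * (1 / ((n : ℝ) + 1)) := fun n m hnm => by
    have hmid : (1 / 2 : ℝ) • x n + (1 / 2 : ℝ) • x m ∈ K n :=
      hconv n (hxK n) (hK hnm (hxK m)) (by norm_num) (by norm_num) (by norm_num)
    have h1 := hale n _ hmid
    rw [← smul_add, norm_smul, mul_pow] at h1
    have h2 := parallelogram_law_with_norm ℝ (x n) (x m)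
    have h3 := hx n
    have h4 := hx m
    have h5 : 1 / ((m : ℝ) + 1) ≤ 1 / ((n : ℝ) + 1) := Nat.one_div_le_one_div hnm
    have h6 := haA m
    have h7 := haA n
    norm_num at h1
    nlinarith
  have hlim : Tendsto (fun n : ℕ => Real.sqrt (4 * (A - a n) + 4 * (1 / ((n : ℝ) + 1)))) atTop
      (nhds 0) := by
    have : Tendsto (fun n : ℕ => 4 * (A - a n) + 4 * (1 / ((n : ℝ) + 1))) atTop
        (nhds (4 * (A - A) + 4 * 0)) :=
      ((tendsto_const_nhds.sub halim).const_mul 4).add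
        (tendsto_one_div_add_atTop_nhds_zero_nat.const_mul 4)
    simpa using this.sqrt
  refine cauchySeq_of_le_tendsto_0' _ (fun n m hnm => ?_) hlim
  rw [dist_eq_norm]
  exact Real.le_sqrt_of_sq_le (key n m hnm)

/-- A decreasing sequence of nonempty convex sets of uniformly bounded random vectors admits an
almost surely convergent sequence of selections. -/
theorem exists_ae_tendsto_of_antitone_convex [MeasurableSpace Ω] (P : Measure Ω)
    [IsProbabilityMeasure P] {d : ℕ} (K : ℕ → Set (Ω → Fin d → ℝ)) (hK : Antitone K)
    (hconv : ∀ n, Convex ℝ (K n)) (hne : ∀ n, (K n).Nonempty) {R : ℝ}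
    (hmeas : ∀ n, ∀ U ∈ K n, Measurable U) (hR : ∀ n, ∀ U ∈ K n, ∀ ω, ‖U ω‖ ≤ R) :
    ∃ U : ℕ → Ω → Fin d → ℝ, (∀ n, U n ∈ K n) ∧ ∃ V : Ω → Fin d → ℝ, Measurable V ∧
      ∀ᵐ ω ∂P, Tendsto (fun n => U n ω) atTop (nhds (V ω)) := by
  let J : (Ω → Fin d → ℝ) → Ω → EuclideanSpace ℝ (Fin d) := fun U ω => WithLp.toLp 2 (U ω)
  have hJb : ∀ n, ∀ U ∈ K n, ∀ ω, ‖J U ω‖ ≤ Real.sqrt (d * R ^ 2) := fun n U hU ω => by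
    rw [EuclideanSpace.norm_eq]
    refine Real.sqrt_le_sqrt ?_
    calc ∑ i, ‖J U ω i‖ ^ 2 ≤ ∑ _i : Fin d, R ^ 2 := Finset.sum_le_sum fun i _ =>
          pow_le_pow_left₀ (norm_nonneg _) ((norm_le_pi_norm (U ω) i).trans (hR n U hU ω)) 2
      _ = d * R ^ 2 := by simp
  have hJm : ∀ n, ∀ U ∈ K n, MemLp (J U) 2 P := fun n U hU =>
    MemLp.of_bound ((WithLp.measurable_toLp 2 _).comp (hmeas n U hU)).aestronglyMeasurable _
      (Eventually.of_forall (hJb n U hU))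
  let K' : ℕ → Set (Lp (EuclideanSpace ℝ (Fin d)) 2 P) := fun n =>
    {f | ∃ U ∈ K n, f =ᵐ[P] J U}
  obtain ⟨x, hxK, z, hz⟩ := exists_tendsto_of_antitone_convex K'
    (fun m n hmn f ⟨U, hU, hf⟩ => ⟨U, hK hmn hU, hf⟩)
    (fun n => by
      rintro f ⟨U, hU, hf⟩ g ⟨V, hV, hg⟩ a b ha hb hab
      refine ⟨a • U + b • V, hconv n hU hV ha hb hab, ?_⟩
      filter_upwards [hf, hg, Lp.coeFn_add (a • f) (b • g), Lp.coeFn_smul a f,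
        Lp.coeFn_smul b g] with ω h1 h2 h3 h4 h5
      rw [h3, Pi.add_apply, h4, h5, Pi.smul_apply, Pi.smul_apply, h1, h2]
      rfl)
    (fun n => by
      obtain ⟨U, hU⟩ := hne n
      exact ⟨(hJm n U hU).toLp _, U, hU, MemLp.coeFn_toLp _⟩)
    (R := Real.sqrt (d * R ^ 2)) (fun n f ⟨U, hU, hf⟩ => by
      have := Lp.norm_le_of_ae_bound (f := f) (C := Real.sqrt (d * R ^ 2)) (Real.sqrt_nonneg _)
        (by filter_upwards [hf] with ω h1; rw [h1]; exact hJb n U hU ω)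
      simpa [measureUnivNNReal] using this)
  choose U hU hxU using hxK
  obtain ⟨ns, hns, hlim⟩ := (tendstoInMeasure_of_tendsto_Lp hz).exists_seq_tendsto_ae
  refine ⟨fun n => U (ns n), fun n => hK hns.le_apply (hU _),
    fun ω => WithLp.ofLp (z ω), (WithLp.measurable_ofLp 2 _).comp
      (Lp.stronglyMeasurable z).measurable, ?_⟩
  filter_upwards [hlim, ae_all_iff.2 hxU] with ω h1 h2
  have h3 := ((PiLp.continuous_ofLp 2 (fun _ : Fin d => ℝ)).tendsto _).comp h1
  refine h3.congr fun n => ?_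
  simp only [Function.comp_apply]
  rw [h2]

/-- The space of bounded measurable functions with values in `E`. -/
def boundedMeasurable (Ω E : Type*) [MeasurableSpace Ω] [NormedAddCommGroup E] [NormedSpace ℝ E]
    [MeasurableSpace E] [BorelSpace E] [SecondCountableTopology E] :
    Submodule ℝ (Ω → E) where
  carrier := {X | Measurable X ∧ ∃ R : ℝ, ∀ ω, ‖X ω‖ ≤ R}
  add_mem' := by
    rintro X Y ⟨hX, R, hR⟩ ⟨hY, S, hS⟩
    exact ⟨hX.add hY, R + S, fun ω => (norm_add_le _ _).trans (add_le_add (hR ω) (hS ω))⟩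
  zero_mem' := ⟨measurable_const, 0, fun ω => by simp⟩
  smul_mem' := by
    rintro c X ⟨hX, R, hR⟩
    exact ⟨hX.const_smul c, ‖c‖ * R, fun ω => by
      rw [Pi.smul_apply, norm_smul]
      exact mul_le_mul_of_nonneg_left (hR ω) (norm_nonneg _)⟩

/-- Continuity of a linear functional along bounded sequences converging almost surely to `0`. -/
def OrderContinuous {E : Type*} [MeasurableSpace Ω] [NormedAddCommGroup E] [NormedSpace ℝ E]
    [MeasurableSpace E] [BorelSpace E] [SecondCountableTopology E] (P : Measure Ω)
    (f : boundedMeasurable Ω E →ₗ[ℝ] ℝ) : Prop :=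
  ∀ (U : ℕ → boundedMeasurable Ω E) (R : ℝ), (∀ n ω, ‖(U n).1 ω‖ ≤ R) →
    (∀ᵐ ω ∂P, Tendsto (fun n => (U n).1 ω) atTop (nhds 0)) →
    Tendsto (fun n => f (U n)) atTop (nhds 0)

/-- The indicator of a measurable set as a bounded measurable function. -/
def indicatorBM [MeasurableSpace Ω] {A : Set Ω} (hA : MeasurableSet A) :
    boundedMeasurable Ω ℝ :=
  ⟨A.indicator fun _ => 1, measurable_const.indicator hA, 1, fun ω => by
    by_cases h : ω ∈ A <;> simp [h]⟩

theorem OrderContinuous.map_eq_zero [MeasurableSpace Ω] {P : Measure Ω}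
    {φ : boundedMeasurable Ω ℝ →ₗ[ℝ] ℝ} (hφ : OrderContinuous P φ) {x : boundedMeasurable Ω ℝ}
    (hx : x.1 =ᵐ[P] 0) : φ x = 0 := by
  obtain ⟨R, hR⟩ := x.2.2
  have := hφ (fun _ => x) R (fun _ => hR) (by
    filter_upwards [hx] with ω h
    rw [h]
    exact tendsto_const_nhds)
  exact tendsto_nhds_unique tendsto_const_nhds this

open Classical in
/-- The signed measure `A ↦ φ (1_A)` attached to an order continuous functional. -/
def signedMeasureOf [MeasurableSpace Ω] {P : Measure Ω} (φ : boundedMeasurable Ω ℝ →ₗ[ℝ] ℝ)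
    (hφ : OrderContinuous P φ) : SignedMeasure Ω where
  measureOf' A := if hA : MeasurableSet A then φ (indicatorBM hA) else 0
  empty' := by
    rw [dif_pos MeasurableSet.empty]
    exact hφ.map_eq_zero (Eventually.of_forall fun ω => by simp [indicatorBM])
  not_measurable' A hA := dif_neg hA
  m_iUnion' A hA hdisj := by
    rw [dif_pos (MeasurableSet.iUnion hA)]
    simp only [hA, dif_pos]
    refine tendsto_of_seq_tendsto fun s hs => ?_
    have hmem : ∀ n : ℕ, ∀ᶠ k in atTop, n ∈ s k := fun n =>
      (hs.eventually (eventually_ge_atTop {n})).mono fun k hk => hk (Finset.mem_singleton_self n)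
    have hval : ∀ k ω, ((∑ n ∈ s k, indicatorBM (hA n)) - indicatorBM (MeasurableSet.iUnion hA) :
        boundedMeasurable Ω ℝ).1 ω =
        (∑ n ∈ s k, (A n).indicator (fun _ => (1 : ℝ)) ω) -
          (⋃ n, A n).indicator (fun _ => 1) ω := fun k ω => by
      simp [indicatorBM]
    have hsum : ∀ n ω, ω ∈ A n → ∀ k, ∑ m ∈ s k, (A m).indicator (fun _ => (1 : ℝ)) ω =
        if n ∈ s k then 1 else 0 := fun n ω hn k => by
      have : ∀ m, (A m).indicator (fun _ => (1 : ℝ)) ω = if n = m then 1 else 0 := fun m => by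
        by_cases h : n = m
        · subst h; simp [hn]
        · have : ω ∉ A m := fun hm => Set.disjoint_left.1 (hdisj h) hn hm
          simp [h, this]
      simp [this]
    have hlim := hφ (fun k => (∑ n ∈ s k, indicatorBM (hA n)) -
        indicatorBM (MeasurableSet.iUnion hA)) 1 (fun k ω => by
        rw [hval]
        by_cases hω : ω ∈ ⋃ n, A n
        · obtain ⟨n, hn⟩ := mem_iUnion.1 hω
          rw [hsum n ω hn, indicator_of_mem hω]
          split_ifs <;> norm_num
        · have : ∀ n, ω ∉ A n := fun n hn => hω (mem_iUnion.2 ⟨n, hn⟩)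
          simp [this]) (Eventually.of_forall fun ω => by
        simp only [hval]
        by_cases hω : ω ∈ ⋃ n, A n
        · obtain ⟨n, hn⟩ := mem_iUnion.1 hω
          refine tendsto_const_nhds.congr' ?_
          filter_upwards [hmem n] with k hk
          rw [hsum n ω hn, indicator_of_mem hω, if_pos hk, sub_self]
        · have : ∀ n, ω ∉ A n := fun n hn => hω (mem_iUnion.2 ⟨n, hn⟩)
          simp [this])
    simp only [map_sub, map_sum] at hlim
    have := hlim.add_const (φ (indicatorBM (MeasurableSet.iUnion hA)))
    simpa [Function.comp_def] using this

theorem signedMeasureOf_apply [MeasurableSpace Ω] {P : Measure Ω}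
    {φ : boundedMeasurable Ω ℝ →ₗ[ℝ] ℝ} (hφ : OrderContinuous P φ) {A : Set Ω}
    (hA : MeasurableSet A) : signedMeasureOf φ hφ A = φ (indicatorBM hA) :=
  dif_pos hA

/-- Order continuous functionals on bounded measurable functions are given by an integrable
density. -/
theorem OrderContinuous.exists_density [MeasurableSpace Ω] {P : Measure Ω}
    [IsProbabilityMeasure P] {φ : boundedMeasurable Ω ℝ →ₗ[ℝ] ℝ} (hφ : OrderContinuous P φ) :
    ∃ v : Ω → ℝ, Integrable v P ∧ ∀ x : boundedMeasurable Ω ℝ, φ x = ∫ ω, v ω * x.1 ω ∂P := by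
  set s := signedMeasureOf φ hφ with hs
  have hac : s ≪ᵥ P.toENNRealVectorMeasure := by
    refine VectorMeasure.AbsolutelyContinuous.mk fun A hA hPA => ?_
    rw [Measure.toENNRealVectorMeasure_apply_measurable hA] at hPA
    rw [hs, signedMeasureOf_apply hφ hA]
    refine hφ.map_eq_zero ?_
    filter_upwards [measure_eq_zero_iff_ae_notMem.1 hPA] with ω hω
    simp [indicatorBM, hω]
  set v := s.rnDeriv P with hv
  have hvi : Integrable v P := SignedMeasure.integrable_rnDeriv s P
  have hsv : P.withDensityᵥ v = s :=
    (SignedMeasure.absolutelyContinuous_iff_withDensityᵥ_rnDeriv_eq s P).1 hac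
  refine ⟨v, hvi, fun x => ?_⟩
  have hmulint : ∀ x : boundedMeasurable Ω ℝ, Integrable (fun ω => v ω * x.1 ω) P := fun x => by
    obtain ⟨hx, R, hR⟩ := x.2
    exact hvi.mul_bdd hx.aestronglyMeasurable (Eventually.of_forall hR)
  have hind : ∀ {A : Set Ω} (hA : MeasurableSet A),
      φ (indicatorBM hA) = ∫ ω, v ω * (indicatorBM hA).1 ω ∂P := fun {A} hA => by
    rw [← signedMeasureOf_apply hφ hA, ← hs, ← hsv, withDensityᵥ_apply hvi hA,
      ← integral_indicator hA]
    congr 1 with ω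
    by_cases h : ω ∈ A <;> simp [indicatorBM, h]
  have hsimple : ∀ (u : SimpleFunc Ω ℝ) (hu : (u : Ω → ℝ) ∈ boundedMeasurable Ω ℝ),
      φ ⟨u, hu⟩ = ∫ ω, v ω * u ω ∂P := fun u => by
    have hmem : ∀ u : SimpleFunc Ω ℝ, (u : Ω → ℝ) ∈ boundedMeasurable Ω ℝ := fun u =>
      ⟨u.measurable, u.exists_forall_norm_le⟩
    induction u using SimpleFunc.induction with
    | const c hA =>
      rename_i A
      intro hu
      have : (⟨_, hu⟩ : boundedMeasurable Ω ℝ) = c • indicatorBM hA := by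
        ext ω
        by_cases h : ω ∈ A <;> simp [indicatorBM, h]
      rw [this, map_smul, hind, smul_eq_mul, ← integral_const_mul]
      congr 1 with ω
      have := congrArg (fun z : boundedMeasurable Ω ℝ => z.1 ω) this
      simp only at this
      rw [this]
      simp only [Submodule.coe_smul, Pi.smul_apply, smul_eq_mul]
      ring
    | add hdisj h1 h2 =>
      rename_i u₁ u₂
      intro hu
      have : (⟨_, hu⟩ : boundedMeasurable Ω ℝ) = ⟨u₁, hmem u₁⟩ + ⟨u₂, hmem u₂⟩ := by
        ext ω; simp
      rw [this, map_add, h1 (hmem u₁), h2 (hmem u₂),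
        ← integral_add (hmulint ⟨u₁, hmem u₁⟩) (hmulint ⟨u₂, hmem u₂⟩)]
      congr 1 with ω
      simp only [SimpleFunc.coe_add, Pi.add_apply]
      ring
  obtain ⟨hx, R, hR⟩ := x.2
  have hxs : StronglyMeasurable x.1 := hx.stronglyMeasurable
  have hR0 : ∀ ω, ‖x.1 ω‖ ≤ max R 0 := fun ω => (hR ω).trans (le_max_left _ _)
  have hun : ∀ n ω, ‖hxs.approxBounded (max R 0) n ω‖ ≤ max R 0 := fun n ω =>
    hxs.norm_approxBounded_le (le_max_right _ _) n ω
  have hut : ∀ ω, Tendsto (fun n => hxs.approxBounded (max R 0) n ω) atTop (nhds (x.1 ω)) :=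
    fun ω => hxs.tendsto_approxBounded_of_norm_le (hR0 ω)
  let u : ℕ → boundedMeasurable Ω ℝ := fun n =>
    ⟨hxs.approxBounded (max R 0) n, SimpleFunc.measurable _, max R 0, hun n⟩
  have h1 : Tendsto (fun n => φ (u n)) atTop (nhds (φ x)) := by
    have := hφ (fun n => u n - x) (max R 0 + max R 0)
      (fun n ω => (norm_sub_le _ _).trans (add_le_add (hun n ω) (hR0 ω)))
      (Eventually.of_forall fun ω => by
        have := (hut ω).sub_const (x.1 ω)
        rw [sub_self] at this
        exact this)
    simp only [map_sub] at this
    simpa using this.add_const (φ x)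
  have h2 : Tendsto (fun n => φ (u n)) atTop (nhds (∫ ω, v ω * x.1 ω ∂P)) := by
    have : (fun n => φ (u n)) = fun n => ∫ ω, v ω * (u n).1 ω ∂P :=
      funext fun n => hsimple _ (u n).2
    rw [this]
    refine tendsto_integral_of_dominated_convergence (fun ω => ‖v ω‖ * max R 0)
      (fun n => (hmulint (u n)).aestronglyMeasurable) (hvi.norm.mul_const _)
      (fun n => Eventually.of_forall fun ω => ?_)
      (Eventually.of_forall fun ω => (hut ω).const_mul _)
    rw [norm_mul]
    exact mul_le_mul_of_nonneg_left (hun n ω) (norm_nonneg _)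
  exact tendsto_nhds_unique h1 h2

/-- The embedding of scalar functions into the `i`-th coordinate. -/
def singleBM [MeasurableSpace Ω] {d : ℕ} (i : Fin d) :
    boundedMeasurable Ω ℝ →ₗ[ℝ] boundedMeasurable Ω (Fin d → ℝ) where
  toFun x := ⟨fun ω => Pi.single i (x.1 ω), by
    obtain ⟨hx, R, hR⟩ := x.2
    refine ⟨measurable_pi_lambda _ fun j => ?_, R, fun ω => ?_⟩
    · by_cases h : j = i
      · subst h; simpa using hx
      · simp [Pi.single_eq_of_ne h]
    · rw [Pi.norm_single]
      exact hR ω⟩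
  map_add' x y := by ext ω : 2; simp [Pi.single_add]
  map_smul' c x := by ext ω j; simp [Pi.single_apply]

/-- Vector-valued version of `OrderContinuous.exists_density`. -/
theorem OrderContinuous.exists_density_pi [MeasurableSpace Ω] {P : Measure Ω}
    [IsProbabilityMeasure P] {d : ℕ} {f : boundedMeasurable Ω (Fin d → ℝ) →ₗ[ℝ] ℝ}
    (hf : OrderContinuous P f) :
    ∃ v : Ω → Fin d → ℝ, (∀ i, Integrable (fun ω => v ω i) P) ∧
      ∀ U : boundedMeasurable Ω (Fin d → ℝ), f U = ∫ ω, dot (v ω) (U.1 ω) ∂P := by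
  have hcoord : ∀ i : Fin d, OrderContinuous P (f ∘ₗ singleBM i) := fun i U R hR hU =>
    hf (fun n => singleBM i (U n)) R
      (fun n ω => by
        change ‖(Pi.single i ((U n).1 ω) : Fin d → ℝ)‖ ≤ R
        rw [Pi.norm_single]
        exact hR n ω)
      (by
        filter_upwards [hU] with ω h
        change Tendsto (fun n => (Pi.single i ((U n).1 ω) : Fin d → ℝ)) atTop (nhds 0)
        rw [← Pi.single_zero i]
        exact ((continuous_single (A := fun _ : Fin d => ℝ) i).tendsto _).comp h)
  choose v hv hfv using fun i => (hcoord i).exists_density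
  refine ⟨fun ω i => v i ω, hv, fun U => ?_⟩
  obtain ⟨hU, R, hR⟩ := U.2
  have hbi : ∀ i ω, ‖U.1 ω i‖ ≤ R := fun i ω => (norm_le_pi_norm _ i).trans (hR ω)
  let x : Fin d → boundedMeasurable Ω ℝ := fun i =>
    ⟨fun ω => U.1 ω i, (measurable_pi_apply i).comp hU, R, hbi i⟩
  have hUx : U = ∑ i, singleBM i (x i) := by
    ext ω j
    rw [Submodule.coe_sum, Finset.sum_apply, Finset.sum_apply]
    simp [singleBM, x, Pi.single_apply]
  rw [hUx, map_sum, ← hUx]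
  unfold dot
  rw [integral_finsetSum _ fun i _ => (hv i).mul_bdd
    (x i).2.1.aestronglyMeasurable (Eventually.of_forall (hbi i))]
  exact Finset.sum_congr rfl fun i _ => hfv i (x i)

theorem absorbent_of_seq {E : Type*} [AddCommGroup E] [Module ℝ E] {W : Set E}
    (h : ∀ (x : E) (c : ℕ → ℝ), Tendsto c atTop (nhds 0) → ∀ᶠ k in atTop, c k • x ∈ W) :
    Absorbent ℝ W :=
  absorbent_iff_eventually_nhdsNE_zero.2 fun x =>
    eventually_iff_seq_eventually.2 fun c hc => h x c (hc.mono_right nhdsWithin_le_nhds)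

/-- A convex set of bounded random vectors that is closed under almost sure limits of bounded
sequences. -/
structure FatouClosedConvex [MeasurableSpace Ω] (P : Measure Ω) {d : ℕ}
    (D : Set (Ω → Fin d → ℝ)) : Prop where
  bdd : ∀ U ∈ D, U ∈ boundedMeasurable Ω (Fin d → ℝ)
  convex : Convex ℝ D
  closed : ∀ (U : ℕ → Ω → Fin d → ℝ) (V : Ω → Fin d → ℝ) (R : ℝ), (∀ n, U n ∈ D) →
    (∀ n ω, ‖U n ω‖ ≤ R) → Measurable V → (∀ ω, ‖V ω‖ ≤ R) →
    (∀ᵐ ω ∂P, Tendsto (fun n => U n ω) atTop (nhds (V ω))) → V ∈ D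

/-- The expected excess of the norm of `U` over the level `n`. -/
def excess [MeasurableSpace Ω] (P : Measure Ω) {d : ℕ} (n : ℕ) (U : Ω → Fin d → ℝ) : ℝ :=
  ∫ ω, max (‖U ω‖ - n) 0 ∂P

section Excess
variable [MeasurableSpace Ω] {P : Measure Ω} {d : ℕ}

theorem abs_max_norm_sub_le {E : Type*} [SeminormedAddCommGroup E] {x : E} {R : ℝ}
    (hx : ‖x‖ ≤ R) (n : ℕ) : ‖max (‖x‖ - n) 0‖ ≤ R := by
  rw [Real.norm_of_nonneg (le_max_right _ _)]
  exact max_le (by linarith [Nat.cast_nonneg (α := ℝ) n]) ((norm_nonneg _).trans hx)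

theorem integrable_excess [IsProbabilityMeasure P] (n : ℕ) {U : Ω → Fin d → ℝ}
    (hU : U ∈ boundedMeasurable Ω (Fin d → ℝ)) :
    Integrable (fun ω => max (‖U ω‖ - n) 0) P := by
  obtain ⟨hm, R, hR⟩ := hU
  exact Integrable.of_bound ((hm.norm.sub_const _).max measurable_const).aestronglyMeasurable R
    (Eventually.of_forall fun ω => abs_max_norm_sub_le (hR ω) n)

theorem excess_nonneg (n : ℕ) (U : Ω → Fin d → ℝ) : 0 ≤ excess P n U :=
  integral_nonneg fun _ => le_max_right _ _

theorem excess_eq_zero {n : ℕ} {U : Ω → Fin d → ℝ} (h : ∀ ω, ‖U ω‖ ≤ n) : excess P n U = 0 := by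
  have : ∀ ω, max (‖U ω‖ - n) 0 = 0 := fun ω => max_eq_right (by linarith [h ω])
  simp [excess, this]

theorem excess_convex [IsProbabilityMeasure P] (n : ℕ) {U V : Ω → Fin d → ℝ}
    (hU : U ∈ boundedMeasurable Ω (Fin d → ℝ)) (hV : V ∈ boundedMeasurable Ω (Fin d → ℝ))
    {a b : ℝ} (ha : 0 ≤ a) (hb : 0 ≤ b) (hab : a + b = 1) :
    excess P n (a • U + b • V) ≤ a * excess P n U + b * excess P n V := by
  have hiU := integrable_excess (P := P) n hU
  have hiV := integrable_excess (P := P) n hV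
  unfold excess
  rw [← integral_const_mul, ← integral_const_mul,
    ← integral_add (hiU.const_mul a) (hiV.const_mul b)]
  refine integral_mono (integrable_excess n (Submodule.add_mem _ (Submodule.smul_mem _ a hU)
    (Submodule.smul_mem _ b hV))) ((hiU.const_mul a).add (hiV.const_mul b)) fun ω => ?_
  have h1 : ‖(a • U + b • V) ω‖ ≤ a * ‖U ω‖ + b * ‖V ω‖ := by
    refine (norm_add_le _ _).trans_eq ?_
    simp [norm_smul, abs_of_nonneg ha, abs_of_nonneg hb]
  have h2 := mul_le_mul_of_nonneg_left (le_max_left (‖U ω‖ - n) 0) ha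
  have h3 := mul_le_mul_of_nonneg_left (le_max_left (‖V ω‖ - n) 0) hb
  have h4 := mul_nonneg ha (le_max_right (‖U ω‖ - n) 0)
  have h5 := mul_nonneg hb (le_max_right (‖V ω‖ - n) 0)
  have h6 : (n : ℝ) = a * n + b * n := by rw [← add_mul, hab, one_mul]
  exact max_le (by linarith) (by linarith)

theorem tendsto_excess [IsProbabilityMeasure P] (n : ℕ) {U : ℕ → Ω → Fin d → ℝ}
    {V : Ω → Fin d → ℝ} {R : ℝ} (hU : ∀ k, Measurable (U k)) (hR : ∀ k ω, ‖U k ω‖ ≤ R)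
    (h : ∀ᵐ ω ∂P, Tendsto (fun k => U k ω) atTop (nhds (V ω))) :
    Tendsto (fun k => excess P n (U k)) atTop (nhds (excess P n V)) := by
  refine tendsto_integral_of_dominated_convergence (fun _ => R)
    (fun k => (integrable_excess n ⟨hU k, R, hR k⟩).aestronglyMeasurable) (integrable_const _)
    (fun k => Eventually.of_forall fun ω => abs_max_norm_sub_le (hR k ω) n) ?_
  filter_upwards [h] with ω hω
  exact (hω.norm.sub_const _).max tendsto_const_nhds

theorem FatouClosedConvex.inter_excess [IsProbabilityMeasure P] {D : Set (Ω → Fin d → ℝ)}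
    (hD : FatouClosedConvex P D) (n : ℕ) (η : ℝ) :
    FatouClosedConvex P (D ∩ {U | excess P n U ≤ η}) where
  bdd U hU := hD.bdd U hU.1
  convex := by
    rintro U ⟨hU, hUη⟩ V ⟨hV, hVη⟩ a b ha hb hab
    refine ⟨hD.convex hU hV ha hb hab,
      (excess_convex n (hD.bdd U hU) (hD.bdd V hV) ha hb hab).trans ?_⟩
    calc a * excess P n U + b * excess P n V ≤ a * η + b * η :=
          add_le_add (mul_le_mul_of_nonneg_left hUη ha) (mul_le_mul_of_nonneg_left hVη hb)
      _ = η := by rw [← add_mul, hab, one_mul]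
  closed U V R hU hR hVm hV hlim :=
    ⟨hD.closed U V R (fun n => (hU n).1) hR hVm hV hlim,
      le_of_tendsto' (tendsto_excess n (fun k => (hD.bdd _ (hU k).1).1) hR hlim)
        fun k => (hU k).2⟩

/-- If `D` has no element bounded by `n`, then small excess over `n` is impossible among the
elements bounded by `n + 1`. -/
theorem FatouClosedConvex.exists_gap [IsProbabilityMeasure P] {D : Set (Ω → Fin d → ℝ)}
    (hD : FatouClosedConvex P D) (n : ℕ) (hn : ∀ U ∈ D, ¬ ∀ ω, ‖U ω‖ ≤ n) :
    ∃ η : ℝ, 0 < η ∧ ∀ U ∈ D ∩ {U | excess P n U ≤ η}, ¬ ∀ ω, ‖U ω‖ ≤ (n + 1 : ℕ) := by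
  by_contra! hcon
  let K : ℕ → Set (Ω → Fin d → ℝ) := fun k =>
    (D ∩ {U | excess P n U ≤ 1 / ((k : ℝ) + 1)}) ∩ {U | ∀ ω, ‖U ω‖ ≤ (n + 1 : ℕ)}
  obtain ⟨U, hU, V, hVm, hlim⟩ := exists_ae_tendsto_of_antitone_convex P K
    (fun j k hjk U hU =>
      ⟨⟨hU.1.1, le_trans (show excess P n U ≤ _ from hU.1.2) (Nat.one_div_le_one_div hjk)⟩, hU.2⟩)
    (fun k => (hD.inter_excess n _).convex.inter <| by
      rintro U hU V hV a b ha hb hab ω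
      have := (convex_closedBall (0 : Fin d → ℝ) ((n + 1 : ℕ) : ℝ))
        (mem_closedBall_zero_iff.2 (hU ω)) (mem_closedBall_zero_iff.2 (hV ω)) ha hb hab
      exact mem_closedBall_zero_iff.1 this)
    (fun k => by
      obtain ⟨U, h1, h2⟩ := hcon _ (Nat.one_div_pos_of_nat (n := k) (α := ℝ))
      exact ⟨U, h1, h2⟩)
    (fun k U hU => (hD.bdd U hU.1.1).1) (fun k U hU => hU.2)
  have hexV : excess P n V ≤ 0 :=
    le_of_tendsto_of_tendsto' (tendsto_excess n (fun k => (hD.bdd _ (hU k).1.1).1)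
      (fun k => (hU k).2) hlim) tendsto_one_div_add_atTop_nhds_zero_nat fun k => (hU k).1.2
  have hVR : ∀ᵐ ω ∂P, ‖V ω‖ ≤ (n + 1 : ℕ) := by
    filter_upwards [hlim] with ω hω
    exact le_of_tendsto' hω.norm fun k => (hU k).2 ω
  have hint : Integrable (fun ω => max (‖V ω‖ - n) 0) P :=
    Integrable.of_bound ((hVm.norm.sub_const _).max measurable_const).aestronglyMeasurable _
      (hVR.mono fun ω h => abs_max_norm_sub_le h n)
  have hVn : ∀ᵐ ω ∂P, ‖V ω‖ ≤ n := by
    have := (integral_eq_zero_iff_of_nonneg (fun _ => le_max_right _ _) hint).1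
      (le_antisymm hexV (excess_nonneg n V))
    filter_upwards [this] with ω hω
    have h := le_max_left (‖V ω‖ - (n : ℝ)) 0
    have hω' : max (‖V ω‖ - (n : ℝ)) 0 = 0 := hω
    linarith
  set V' : Ω → Fin d → ℝ := {ω | ‖V ω‖ ≤ n}.indicator V with hV'
  have hV'n : ∀ ω, ‖V' ω‖ ≤ n := fun ω => by
    by_cases h : ‖V ω‖ ≤ n
    · rw [hV', indicator_of_mem (show ω ∈ {ω | ‖V ω‖ ≤ n} from h)]; exact h
    · rw [hV', indicator_of_notMem (show ω ∉ {ω | ‖V ω‖ ≤ n} from h), norm_zero]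
      exact Nat.cast_nonneg n
  refine hn V' (hD.closed U V' ((n + 1 : ℕ) : ℝ) (fun k => (hU k).1.1) (fun k => (hU k).2)
    (hVm.indicator (measurableSet_le hVm.norm measurable_const))
    (fun ω => (hV'n ω).trans (by push_cast; linarith)) ?_) hV'n
  filter_upwards [hlim, hVn] with ω h1 h2
  rwa [hV', indicator_of_mem (show ω ∈ {ω | ‖V ω‖ ≤ n} from h2)]

/-- **Separation theorem**: a nonempty convex set of bounded random vectors that is closed under
almost sure limits of bounded sequences and does not contain `0` is strictly separated from `0` by
an integrable random vector. -/
theorem FatouClosedConvex.exists_separating_density [IsProbabilityMeasure P]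
    {D : Set (Ω → Fin d → ℝ)} (hD : FatouClosedConvex P D) (hne : D.Nonempty) (h0 : 0 ∉ D) :
    ∃ v : Ω → Fin d → ℝ, (∀ i, Integrable (fun ω => v ω i) P) ∧
      ∃ δ : ℝ, 0 < δ ∧ ∀ U ∈ D, δ ≤ ∫ ω, dot (v ω) (U ω) ∂P := by
  have hstep : ∀ (n : ℕ) (B : Set (Ω → Fin d → ℝ)), ∃ η : ℝ, 0 < η ∧ (FatouClosedConvex P B →
      (∀ U ∈ B, ¬ ∀ ω, ‖U ω‖ ≤ n) →
      ∀ U ∈ B ∩ {U | excess P n U ≤ η}, ¬ ∀ ω, ‖U ω‖ ≤ (n + 1 : ℕ)) := fun n B => by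
    by_cases h : FatouClosedConvex P B ∧ ∀ U ∈ B, ¬ ∀ ω, ‖U ω‖ ≤ n
    · obtain ⟨η, hη, hU⟩ := h.1.exists_gap n h.2
      exact ⟨η, hη, fun _ _ => hU⟩
    · exact ⟨1, one_pos, fun h1 h2 => absurd ⟨h1, h2⟩ h⟩
  choose η hη hstep using hstep
  let B : ℕ → Set (Ω → Fin d → ℝ) := fun n =>
    Nat.rec D (fun n B => B ∩ {U | excess P n U ≤ η n B}) n
  have hB : ∀ n, FatouClosedConvex P (B n) ∧ ∀ U ∈ B n, ¬ ∀ ω, ‖U ω‖ ≤ n := fun n => by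
    induction n with
    | zero =>
      refine ⟨hD, fun U hU h => h0 ?_⟩
      have : U = 0 := funext fun ω => norm_le_zero_iff.1 (by simpa using h ω)
      exact this ▸ hU
    | succ n ih => exact ⟨ih.1.inter_excess n _, hstep n (B n) ih.1 ih.2⟩
  set E := boundedMeasurable Ω (Fin d → ℝ)
  let W : Set E := {U | ∀ n, excess P n U.1 ≤ η n (B n)}
  let C : Set E := {U | U.1 ∈ D}
  have hWconv : Convex ℝ W := by
    intro U hU V hV a b ha hb hab n
    calc excess P n (a • U + b • V : E).1 ≤ a * excess P n U.1 + b * excess P n V.1 :=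
          excess_convex n U.2 V.2 ha hb hab
      _ ≤ a * η n (B n) + b * η n (B n) :=
          add_le_add (mul_le_mul_of_nonneg_left (hU n) ha) (mul_le_mul_of_nonneg_left (hV n) hb)
      _ = η n (B n) := by rw [← add_mul, hab, one_mul]
  have hdisj : Disjoint W C := by
    refine Set.disjoint_left.2 fun U hU hUD => ?_
    have hUB : ∀ n, U.1 ∈ B n := fun n => by
      induction n with
      | zero => exact hUD
      | succ n ih => exact ⟨ih, hU n⟩
    obtain ⟨R, hR⟩ := U.2.2
    obtain ⟨n, hn⟩ := exists_nat_ge R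
    exact (hB n).2 U.1 (hUB n) fun ω => (hR ω).trans hn
  have hWev : ∀ (U : ℕ → E) (R : ℝ), (∀ n ω, ‖(U n).1 ω‖ ≤ R) →
      (∀ᵐ ω ∂P, Tendsto (fun n => (U n).1 ω) atTop (nhds 0)) → ∀ᶠ k in atTop, U k ∈ W := by
    intro U R hR hlim
    obtain ⟨N, hN⟩ := exists_nat_ge R
    have hfin : ∀ n ∈ Finset.range N, ∀ᶠ k in atTop, excess P n (U k).1 ≤ η n (B n) :=
      fun n _ => by
        have := tendsto_excess (V := 0) n (fun k => (U k).2.1) hR hlim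
        rw [excess_eq_zero (by simp)] at this
        exact this.eventually (eventually_le_nhds (hη n (B n)))
    filter_upwards [(Finset.eventually_all _).2 hfin] with k hk n
    by_cases hn : n < N
    · exact hk n (Finset.mem_range.2 hn)
    · rw [excess_eq_zero fun ω => (hR k ω).trans (hN.trans (Nat.cast_le.2 (not_lt.1 hn)))]
      exact (hη n (B n)).le
  have hWabs : Absorbent ℝ W := by
    refine absorbent_of_seq (E := E) (W := W) ?_
    intro U c hc0
    obtain ⟨R, hR⟩ := U.2.2
    obtain ⟨M, hM⟩ := hc0.norm.bddAbove_range
    have hcM : ∀ k, ‖c k‖ ≤ M := fun k => hM (mem_range_self k)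
    refine hWev (fun k => c k • U) (M * R) (fun k ω => ?_) (Eventually.of_forall fun ω => ?_)
    · change ‖c k • U.1 ω‖ ≤ _
      rw [norm_smul]
      exact mul_le_mul (hcM k) (hR ω) (norm_nonneg _) ((norm_nonneg _).trans (hcM k))
    · have := hc0.smul_const (U.1 ω)
      rwa [zero_smul] at this
  obtain ⟨f, hfW, δ, hδ, hfC⟩ := exists_linear_separation hWconv hWabs
    (show Convex ℝ C from fun U hU V hV a b ha hb hab => hD.convex hU hV ha hb hab)
    (by obtain ⟨U, hU⟩ := hne; exact ⟨⟨U, hD.bdd U hU⟩, hU⟩) hdisj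
  have hford : OrderContinuous P f := by
    intro U R hR hlim
    rw [Metric.tendsto_atTop']
    intro ε hε
    have hev : ∀ c : ℝ, ∀ᶠ k in atTop, c * f (U k) ≤ 1 := fun c => by
      refine (hWev (fun k => c • U k) (‖c‖ * R) (fun k ω => ?_) ?_).mono fun k hk => ?_
      · change ‖c • (U k).1 ω‖ ≤ _
        rw [norm_smul]
        exact mul_le_mul_of_nonneg_left (hR k ω) (norm_nonneg _)
      · filter_upwards [hlim] with ω hω
        have := hω.const_smul c
        rwa [smul_zero] at this
      · have := hfW _ hk
        rwa [map_smul, smul_eq_mul] at this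
    obtain ⟨N, hN⟩ := eventually_atTop.1 ((hev (2 / ε)).and (hev (-(2 / ε))))
    refine ⟨N, fun k hk => ?_⟩
    obtain ⟨h1, h2⟩ := hN k hk.le
    rw [Real.dist_eq, sub_zero]
    have h3 : 2 / ε * |f (U k)| ≤ 1 := by
      rcases abs_cases (f (U k)) with ⟨h, -⟩ | ⟨h, -⟩ <;> rw [h] <;> linarith
    rw [div_mul_eq_mul_div, div_le_one hε] at h3
    linarith
  obtain ⟨v, hv, hfv⟩ := hford.exists_density_pi
  exact ⟨v, hv, δ, hδ, fun U hU => hfv ⟨U, hD.bdd U hU⟩ ▸ hfC ⟨U, hD.bdd U hU⟩ hU⟩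

end Excess

theorem ae_nonpos_of_integral_posPart_le [MeasurableSpace Ω] {P : Measure Ω} {f : Ω → ℝ}
    (hf : Integrable f P) (h : ∀ ε > 0, ∫ ω, max (f ω) 0 ∂P ≤ ε) : ∀ᵐ ω ∂P, f ω ≤ 0 := by
  have h0 : ∫ ω, max (f ω) 0 ∂P = 0 :=
    le_antisymm (le_of_forall_pos_le_add fun ε hε => by simpa using h ε hε)
      (integral_nonneg fun ω => le_max_right _ _)
  have h1 := (integral_eq_zero_iff_of_nonneg (f := fun ω => max (f ω) 0)
    (fun ω => le_max_right _ _) hf.pos_part).1 h0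
  filter_upwards [h1] with ω hω
  exact max_eq_right_iff.1 hω

theorem exists_integrable_upper_bound_of_monotone [MeasurableSpace Ω] {P : Measure Ω}
    {h : ℕ → Ω → ℝ} (hint : ∀ n, Integrable (h n) P) (hmono : ∀ n, h n ≤ᵐ[P] h (n + 1)) {c : ℝ}
    (hc : ∀ n, ∫ ω, h n ω ∂P ≤ c) :
    ∃ g, Integrable g P ∧ (∀ n, h n ≤ᵐ[P] g) ∧ ∫ ω, g ω ∂P ≤ c := by
  have hmono' : ∀ᵐ ω ∂P, Monotone fun n => h n ω := by
    filter_upwards [ae_all_iff.2 hmono] with ω hω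
    exact monotone_nat_of_le_succ hω
  set G : Ω → ENNReal := fun ω => ⨆ n, ENNReal.ofReal (h n ω - h 0 ω) with hG
  have hmeas : ∀ n, AEMeasurable (fun ω => ENNReal.ofReal (h n ω - h 0 ω)) P := fun n =>
    ((hint n).sub (hint 0)).aemeasurable.ennreal_ofReal
  have hGm : AEMeasurable G P := AEMeasurable.iSup hmeas
  have hlin : ∫⁻ ω, G ω ∂P ≤ ENNReal.ofReal (c - ∫ ω, h 0 ω ∂P) := by
    rw [lintegral_iSup' hmeas]
    · refine iSup_le fun n => ?_
      rw [← ofReal_integral_eq_lintegral_ofReal (f := fun ω => h n ω - h 0 ω)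
        ((hint n).sub (hint 0)), integral_sub (hint n) (hint 0)]
      · exact ENNReal.ofReal_le_ofReal (by linarith [hc n])
      · filter_upwards [hmono'] with ω hω
        simpa using hω (Nat.zero_le n)
    · filter_upwards [hmono'] with ω hω a b hab
      exact ENNReal.ofReal_le_ofReal (by linarith [hω hab])
  have hfin : ∫⁻ ω, G ω ∂P ≠ ⊤ := ne_top_of_le_ne_top ENNReal.ofReal_ne_top hlin
  have hGint : Integrable (fun ω => (G ω).toReal) P :=
    integrable_toReal_of_lintegral_ne_top hGm hfin
  refine ⟨fun ω => h 0 ω + (G ω).toReal, (hint 0).add hGint, fun n => ?_, ?_⟩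
  · filter_upwards [ae_lt_top' hGm hfin] with ω hω
    have : ENNReal.ofReal (h n ω - h 0 ω) ≤ G ω :=
      le_iSup (fun n => ENNReal.ofReal (h n ω - h 0 ω)) n
    have := (ENNReal.ofReal_le_iff_le_toReal hω.ne).1 this
    linarith
  · rw [integral_add (hint 0) hGint, integral_toReal hGm (ae_lt_top' hGm hfin)]
    have h1 := ENNReal.toReal_mono ENNReal.ofReal_ne_top hlin
    rw [ENNReal.toReal_ofReal (by linarith [hc 0])] at h1
    linarith

theorem exists_integrable_upper_bound_of_directed [MeasurableSpace Ω] {P : Measure Ω}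
    {S : Set (Ω → ℝ)} (hne : S.Nonempty) (hint : ∀ f ∈ S, Integrable f P)
    (hdir : ∀ f ∈ S, ∀ g ∈ S, ∃ k ∈ S, f ≤ᵐ[P] k ∧ g ≤ᵐ[P] k) {c : ℝ}
    (hc : ∀ f ∈ S, ∫ ω, f ω ∂P ≤ c) :
    ∃ g, Integrable g P ∧ (∀ f ∈ S, f ≤ᵐ[P] g) ∧ ∫ ω, g ω ∂P ≤ c := by
  set s : ℝ := sSup ((fun f : Ω → ℝ => ∫ ω, f ω ∂P) '' S) with hs
  have hbdd : BddAbove ((fun f : Ω → ℝ => ∫ ω, f ω ∂P) '' S) := by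
    refine ⟨c, ?_⟩
    rintro _ ⟨f, hf, rfl⟩
    exact hc f hf
  have hle : ∀ f ∈ S, ∫ ω, f ω ∂P ≤ s := fun f hf => le_csSup hbdd ⟨f, hf, rfl⟩
  have hsc : s ≤ c := csSup_le (hne.image _) (by rintro _ ⟨f, hf, rfl⟩; exact hc f hf)
  have happ : ∀ n : ℕ, ∃ f ∈ S, s - 1 / ((n : ℝ) + 1) < ∫ ω, f ω ∂P := fun n => by
    obtain ⟨_, ⟨f, hf, rfl⟩, h⟩ := exists_lt_of_lt_csSup (hne.image fun f : Ω → ℝ => ∫ ω, f ω ∂P)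
      (sub_lt_self s (show 0 < 1 / ((n : ℝ) + 1) by positivity))
    exact ⟨f, hf, h⟩
  choose f hfS hf using happ
  have hdir' : ∀ a b : S, ∃ k : S, a.1 ≤ᵐ[P] k.1 ∧ b.1 ≤ᵐ[P] k.1 := fun a b => by
    obtain ⟨k, hk, h⟩ := hdir a a.2 b b.2
    exact ⟨⟨k, hk⟩, h⟩
  choose k hk1 hk2 using hdir'
  let h : ℕ → S := fun n => Nat.rec ⟨f 0, hfS 0⟩ (fun n a => k a ⟨f (n + 1), hfS (n + 1)⟩) n
  have hfh : ∀ n, f n ≤ᵐ[P] (h n).1 := fun n => by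
    cases n with
    | zero => exact EventuallyLE.rfl
    | succ n => exact hk2 (h n) ⟨f (n + 1), hfS (n + 1)⟩
  obtain ⟨g, hg, hhg, hgs⟩ := exists_integrable_upper_bound_of_monotone (h := fun n => (h n).1)
    (fun n => hint _ (h n).2) (fun n => hk1 _ _) (fun n => hle _ (h n).2)
  refine ⟨g, hg, fun u hu => ?_, hgs.trans hsc⟩
  have key : ∀ᵐ ω ∂P, u ω - g ω ≤ 0 := by
    refine ae_nonpos_of_integral_posPart_le ((hint u hu).sub hg) fun ε hε => ?_
    obtain ⟨n, hn⟩ := exists_nat_one_div_lt hε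
    obtain ⟨w, hw, huw, hhw⟩ := hdir u hu _ (h n).2
    calc ∫ ω, max (u ω - g ω) 0 ∂P ≤ ∫ ω, (w ω - (h n).1 ω) ∂P := by
          refine integral_mono_ae ((hint u hu).sub hg).pos_part
            ((hint w hw).sub (hint _ (h n).2)) ?_
          filter_upwards [huw, hhw, hhg n] with ω h1 h2 h3
          exact max_le (by linarith) (by linarith)
      _ = ∫ ω, w ω ∂P - ∫ ω, (h n).1 ω ∂P := integral_sub (hint w hw) (hint _ (h n).2)
      _ ≤ ε := by
          have h1 := hle w hw
          have h2 := hf n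
          have h3 := integral_mono_ae (hint _ (hfS n)) (hint _ (h n).2) (hfh n)
          linarith
  filter_upwards [key] with ω hω
  linarith

theorem tendsto_condExp_of_dominated {m m0 : MeasurableSpace Ω} {P : Measure Ω} (hm : m ≤ m0)
    [SigmaFinite (P.trim hm)] {f : ℕ → Ω → ℝ} {f' b : Ω → ℝ} (hf : ∀ n, Integrable (f n) P)
    (hf' : Integrable f' P) (hb : Integrable b P) (hfb : ∀ n, ∀ᵐ ω ∂P, |f n ω - f' ω| ≤ b ω)
    (hlim : ∀ᵐ ω ∂P, Tendsto (fun n => f n ω) atTop (nhds (f' ω))) :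
    ∀ᵐ ω ∂P, Tendsto (fun n => (P[f n|m]) ω) atTop (nhds ((P[f'|m]) ω)) := by
  have hfb' := ae_all_iff.2 hfb
  set s : ℕ → Ω → ℝ := fun n ω => ⨆ k, |f (n + k) ω - f' ω| with hs
  have hbd : ∀ᵐ ω ∂P, ∀ n, BddAbove (range fun k => |f (n + k) ω - f' ω|) := by
    filter_upwards [hfb'] with ω hω n
    exact ⟨b ω, by rintro _ ⟨k, rfl⟩; exact hω _⟩
  have hs0 : ∀ n ω, 0 ≤ s n ω := fun n ω => Real.iSup_nonneg fun k => abs_nonneg _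
  have hsb : ∀ n, ∀ᵐ ω ∂P, s n ω ≤ b ω := fun n => by
    filter_upwards [hfb'] with ω hω
    exact ciSup_le fun k => hω _
  have hsm : ∀ n, AEMeasurable (s n) P := fun n =>
    AEMeasurable.iSup fun k => ((hf (n + k)).sub hf').aemeasurable.abs
  have hsi : ∀ n, Integrable (s n) P := fun n => by
    refine hb.mono' (hsm n).aestronglyMeasurable ?_
    filter_upwards [hsb n] with ω hω
    rwa [Real.norm_of_nonneg (hs0 n ω)]
  have hle : ∀ᵐ ω ∂P, ∀ n, |f n ω - f' ω| ≤ s n ω := by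
    filter_upwards [hbd] with ω hω n
    simpa using le_ciSup (hω n) 0
  have hanti : ∀ n, s (n + 1) ≤ᵐ[P] s n := fun n => by
    filter_upwards [hbd] with ω hω
    refine ciSup_le fun k => ?_
    have := le_ciSup (hω n) (1 + k)
    simpa [add_assoc] using this
  have hs_lim : ∀ᵐ ω ∂P, Tendsto (fun n => s n ω) atTop (nhds 0) := by
    filter_upwards [hlim] with ω hω
    rw [Metric.tendsto_atTop] at hω ⊢
    intro ε hε
    obtain ⟨N, hN⟩ := hω (ε / 2) (half_pos hε)
    refine ⟨N, fun n hn => ?_⟩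
    have : s n ω ≤ ε / 2 := ciSup_le fun k => (hN (n + k) (by omega)).le
    rw [Real.dist_eq, sub_zero, abs_of_nonneg (hs0 n ω)]
    linarith
  have hint : Tendsto (fun n => ∫ ω, s n ω ∂P) atTop (nhds 0) := by
    have := tendsto_integral_of_dominated_convergence (F := s) (f := fun _ => (0 : ℝ)) b
      (fun n => (hsm n).aestronglyMeasurable) hb
      (fun n => by filter_upwards [hsb n] with ω hω; rwa [Real.norm_of_nonneg (hs0 n ω)]) hs_lim
    simpa using this
  have hcn : ∀ᵐ ω ∂P, ∀ n, 0 ≤ (P[s n|m]) ω := ae_all_iff.2 fun n =>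
    condExp_nonneg (Eventually.of_forall (hs0 n))
  have hca : ∀ᵐ ω ∂P, Antitone fun n => (P[s n|m]) ω := by
    filter_upwards [ae_all_iff.2 fun n => condExp_mono (m := m) (hsi (n + 1)) (hsi n) (hanti n)]
      with ω hω
    exact antitone_nat_of_succ_le hω
  set L : Ω → ℝ := fun ω => ⨅ n, (P[s n|m]) ω with hL
  have hbb : ∀ᵐ ω ∂P, BddBelow (range fun n => (P[s n|m]) ω) := by
    filter_upwards [hcn] with ω hω
    exact ⟨0, by rintro _ ⟨k, rfl⟩; exact hω _⟩
  have hL0 : 0 ≤ᵐ[P] L := by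
    filter_upwards [hcn] with ω hω
    exact le_ciInf hω
  have hLle : ∀ n, L ≤ᵐ[P] P[s n|m] := fun n => by
    filter_upwards [hbb] with ω hω
    exact ciInf_le hω n
  have hLi : Integrable L P := by
    refine (integrable_condExp (m := m) (f := s 0)).mono'
      (AEMeasurable.iInf fun n => integrable_condExp.aemeasurable).aestronglyMeasurable ?_
    filter_upwards [hL0, hLle 0] with ω h0 h1
    rwa [Real.norm_of_nonneg h0]
  have hLz : L =ᵐ[P] 0 := by
    rw [← integral_eq_zero_iff_of_nonneg_ae hL0 hLi]
    refine le_antisymm (ge_of_tendsto' hint fun n => ?_) (integral_nonneg_of_ae hL0)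
    rw [← integral_condExp hm (f := s n)]
    exact integral_mono_ae hLi integrable_condExp (hLle n)
  have hdiff : ∀ᵐ ω ∂P, ∀ n, |(P[f n|m]) ω - (P[f'|m]) ω| ≤ (P[s n|m]) ω := by
    refine ae_all_iff.2 fun n => ?_
    have h1 := condExp_mono (m := m) ((hf n).sub hf') (hsi n)
      (by filter_upwards [hle] with ω hω; exact (le_abs_self _).trans (hω n))
    have h2 := condExp_mono (m := m) (hf'.sub (hf n)) (hsi n)
      (by filter_upwards [hle] with ω hω
          exact ((le_abs_self _).trans_eq (abs_sub_comm _ _)).trans (hω n))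
    filter_upwards [h1, h2, condExp_sub (hf n) hf' m, condExp_sub hf' (hf n) m] with ω a1 a2 a3 a4
    rw [a3] at a1
    rw [a4] at a2
    simp only [Pi.sub_apply] at a1 a2
    exact abs_le.2 ⟨by linarith, a1⟩
  filter_upwards [hdiff, hca, hbb, hLz] with ω h1 h2 h3 h4
  have h5 := tendsto_atTop_ciInf h2 h3
  have h6 : (⨅ n, (P[s n|m]) ω) = 0 := h4
  rw [h6] at h5
  rw [tendsto_iff_dist_tendsto_zero]
  exact squeeze_zero (fun n => dist_nonneg) h1 h5

/-- A density `v` divided by its conditional expectation, set to `1` where the latter vanishes. -/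
def condNormalize [MeasurableSpace Ω] (P : Measure Ω) (m : MeasurableSpace Ω) (v : Ω → ℝ) :
    Ω → ℝ := fun ω => if 0 < (P[v|m]) ω then v ω / (P[v|m]) ω else 1

section CondNormalize
variable {m m0 : MeasurableSpace Ω} {P : Measure Ω} {v : Ω → ℝ}

theorem condNormalize_eq :
    condNormalize P m v =
      (fun ω => {ω | 0 < (P[v|m]) ω}.indicator (fun ω => ((P[v|m]) ω)⁻¹) ω * v ω)
      + {ω | 0 < (P[v|m]) ω}ᶜ.indicator 1 := by
  funext ω
  by_cases h : 0 < (P[v|m]) ω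
  · simp [condNormalize, h, div_eq_inv_mul]
  · simp [condNormalize, h]

theorem condNormalize_nonneg (hv0 : 0 ≤ᵐ[P] v) : 0 ≤ᵐ[P] condNormalize P m v := by
  filter_upwards [hv0] with ω h
  unfold condNormalize
  split_ifs with h1
  · exact div_nonneg h h1.le
  · exact zero_le_one

variable [IsProbabilityMeasure P]

theorem integrable_indicator_inv_condExp_mul (hm : m ≤ m0) (hv : Integrable v P)
    (hv0 : 0 ≤ᵐ[P] v) :
    Integrable (fun ω => {ω | 0 < (P[v|m]) ω}.indicator (fun ω => ((P[v|m]) ω)⁻¹) ω * v ω) P := by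
  set D := P[v|m] with hD
  have hDm : Measurable[m] D := stronglyMeasurable_condExp.measurable
  set A : ℕ → Set Ω := fun n => {ω | 1 / ((n : ℝ) + 1) < D ω} with hA
  have hAm : ∀ n, MeasurableSet[m] (A n) := fun n => measurableSet_lt measurable_const hDm
  set g : ℕ → Ω → ℝ := fun n => (A n).indicator fun ω => (D ω)⁻¹ with hg
  have hgm : ∀ n, StronglyMeasurable[m] (g n) := fun n =>
    (Measurable.indicator hDm.inv (hAm n)).stronglyMeasurable
  have hpos : ∀ (n : ℕ) ω, ω ∈ A n → 0 < D ω := fun n ω h =>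
    lt_trans (by positivity) (show 1 / ((n : ℝ) + 1) < D ω from h)
  have hg0 : ∀ n ω, 0 ≤ g n ω := fun n ω => by
    refine indicator_nonneg (fun ω h => ?_) ω
    exact inv_nonneg.2 (hpos n ω h).le
  have hgb : ∀ (n : ℕ) ω, ‖g n ω‖ ≤ (n : ℝ) + 1 := fun n ω => by
    rw [Real.norm_of_nonneg (hg0 n ω)]
    by_cases h : ω ∈ A n
    · rw [show g n ω = (D ω)⁻¹ from indicator_of_mem h _]
      have h' : 1 / ((n : ℝ) + 1) < D ω := h
      have := inv_anti₀ (by positivity) h'.le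
      simpa using this
    · rw [show g n ω = 0 from indicator_of_notMem h _]
      positivity
  have hgi : ∀ n, Integrable (fun ω => g n ω * v ω) P := fun n =>
    hv.bdd_mul ((hgm n).mono hm).aestronglyMeasurable (Eventually.of_forall (hgb n))
  have hbound : ∀ n, ∫ ω, g n ω * v ω ∂P ≤ 1 := fun n => by
    have h1 : P[fun ω => g n ω * v ω|m] =ᵐ[P] g n * D :=
      condExp_mul_of_stronglyMeasurable_left (hgm n) (hgi n) hv
    rw [← integral_condExp hm, integral_congr_ae h1]
    calc ∫ ω, (g n * D) ω ∂P ≤ ∫ _, (1 : ℝ) ∂P := by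
          refine integral_mono_of_nonneg ?_ (integrable_const _) ?_
          · filter_upwards [condExp_nonneg (m := m) hv0] with ω hω
            exact mul_nonneg (hg0 n ω) hω
          · refine Eventually.of_forall fun ω => ?_
            by_cases h : ω ∈ A n
            · simp [hg, indicator_of_mem h, (hpos n ω h).ne']
            · simp [hg, indicator_of_notMem h]
      _ = 1 := by simp
  have hAmono : ∀ n, A n ⊆ A (n + 1) := fun n ω h => by
    have h' : 1 / ((n : ℝ) + 1) < D ω := h
    refine lt_of_le_of_lt ?_ h'
    push_cast
    exact one_div_le_one_div_of_le (by positivity) (by linarith)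
  obtain ⟨b, hb, hgb', -⟩ := exists_integrable_upper_bound_of_monotone hgi (fun n => by
    filter_upwards [hv0] with ω hω
    refine mul_le_mul_of_nonneg_right ?_ hω
    by_cases h : ω ∈ A n
    · rw [hg]
      simp only [indicator_of_mem h, indicator_of_mem (hAmono n h), le_refl]
    · rw [show g n ω = 0 from indicator_of_notMem h _]
      exact hg0 _ _) hbound
  have hBm : MeasurableSet[m] {ω | 0 < D ω} := measurableSet_lt measurable_const hDm
  refine hb.abs.mono' ?_ ?_
  · exact ((Measurable.indicator hDm.inv hBm).mono hm le_rfl).aestronglyMeasurable.mul hv.1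
  · filter_upwards [ae_all_iff.2 hgb', hv0] with ω h1 h2
    by_cases h : 0 < D ω
    · obtain ⟨n, hn⟩ := exists_nat_one_div_lt h
      have h3 := h1 n
      have h4 : g n ω = (D ω)⁻¹ := indicator_of_mem (show ω ∈ A n from hn) _
      rw [h4] at h3
      have h5 : {ω | 0 < D ω}.indicator (fun ω => (D ω)⁻¹) ω = (D ω)⁻¹ := indicator_of_mem h _
      rw [h5, Real.norm_of_nonneg (mul_nonneg (inv_nonneg.2 h.le) h2)]
      exact h3.trans (le_abs_self _)
    · have h5 : {ω | 0 < D ω}.indicator (fun ω => (D ω)⁻¹) ω = 0 := indicator_of_notMem h _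
      rw [h5, zero_mul, norm_zero]
      exact abs_nonneg _

theorem integrable_condNormalize (hm : m ≤ m0) (hv : Integrable v P) (hv0 : 0 ≤ᵐ[P] v) :
    Integrable (condNormalize P m v) P := by
  rw [condNormalize_eq]
  refine (integrable_indicator_inv_condExp_mul hm hv hv0).add
    ((integrable_const (1 : ℝ)).indicator (MeasurableSet.compl (hm _ ?_)))
  exact measurableSet_lt measurable_const stronglyMeasurable_condExp.measurable

theorem condExp_condNormalize (hm : m ≤ m0) (hv : Integrable v P) (hv0 : 0 ≤ᵐ[P] v) :
    P[condNormalize P m v|m] =ᵐ[P] fun _ => 1 := by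
  have hDm : Measurable[m] (P[v|m]) := stronglyMeasurable_condExp.measurable
  have hBm : MeasurableSet[m] {ω | 0 < (P[v|m]) ω} := measurableSet_lt measurable_const hDm
  have hi := integrable_indicator_inv_condExp_mul hm hv hv0
  have hc : StronglyMeasurable[m] ({ω | 0 < (P[v|m]) ω}ᶜ.indicator (1 : Ω → ℝ)) :=
    (Measurable.indicator measurable_const hBm.compl).stronglyMeasurable
  have hci : Integrable ({ω | 0 < (P[v|m]) ω}ᶜ.indicator (1 : Ω → ℝ)) P :=
    (integrable_const (1 : ℝ)).indicator (hm _ hBm.compl)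
  have h1 := condExp_mul_of_stronglyMeasurable_left
    (Measurable.indicator hDm.inv hBm).stronglyMeasurable hi hv
  rw [condNormalize_eq]
  filter_upwards [condExp_add hi hci m, h1] with ω h2 h3
  rw [h2, Pi.add_apply, condExp_of_stronglyMeasurable hm hc hci]
  refine (congrArg (· + _) h3).trans ?_
  by_cases h : 0 < (P[v|m]) ω
  · simp [h, h.ne']
  · simp [h]

theorem max_condExp_mul_condNormalize (hm : m ≤ m0) (hv : Integrable v P) (hv0 : 0 ≤ᵐ[P] v) :
    (fun ω => max ((P[v|m]) ω) 0 * condNormalize P m v ω) =ᵐ[P] v := by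
  have hDm : Measurable[m] (P[v|m]) := stronglyMeasurable_condExp.measurable
  have hBm : MeasurableSet[m] {ω | (P[v|m]) ω ≤ 0} := measurableSet_le hDm measurable_const
  have h0 : ∫ ω in {ω | (P[v|m]) ω ≤ 0}, v ω ∂P = 0 := by
    refine le_antisymm ?_ (setIntegral_nonneg_of_ae hv0)
    rw [← setIntegral_condExp hm hv hBm]
    exact setIntegral_nonpos (hm _ hBm) fun ω h => h
  rw [setIntegral_eq_zero_iff_of_nonneg_ae (ae_restrict_of_ae hv0) hv.integrableOn] at h0
  have h1 := (ae_restrict_iff' (hm _ hBm)).1 h0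
  filter_upwards [h1] with ω hω
  by_cases h : 0 < (P[v|m]) ω
  · simp [condNormalize, h, h.le, mul_div_cancel₀, h.ne']
  · have := hω (not_lt.1 h)
    simp [max_eq_right (not_lt.1 h), this]

end CondNormalize

section XiBar
variable [MeasurableSpace Ω] {P Q : Measure Ω} {F : ℕ → MeasurableSpace Ω}

theorem integrable_rnd [IsFiniteMeasure Q] : Integrable (rnd P Q) P :=
  Measure.integrable_toReal_rnDeriv

theorem rnd_nonneg : 0 ≤ᵐ[P] rnd P Q := Eventually.of_forall fun _ => ENNReal.toReal_nonneg

theorem xiBar_nonneg (t : ℕ) (ω : Ω) : 0 ≤ xiBar F P Q t ω := by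
  unfold xiBar
  split_ifs with h
  · exact div_nonneg ENNReal.toReal_nonneg h.le
  · exact zero_le_one

variable [IsProbabilityMeasure P]

theorem integrable_xiBar [IsFiniteMeasure Q] {t : ℕ} (hm : F t ≤ ‹MeasurableSpace Ω›) :
    Integrable (xiBar F P Q t) P :=
  integrable_condNormalize hm integrable_rnd rnd_nonneg

theorem condExp_xiBar [IsFiniteMeasure Q] {t : ℕ} (hm : F t ≤ ‹MeasurableSpace Ω›) :
    P[xiBar F P Q t|F t] =ᵐ[P] fun _ => 1 :=
  condExp_condNormalize hm integrable_rnd rnd_nonneg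

/-- A conditionally normalized density is the conditional density of a probability measure. -/
theorem exists_measure_xiBar_eq {t : ℕ} (hm : F t ≤ ‹MeasurableSpace Ω›) {v : Ω → ℝ}
    (hv : Integrable v P) (hv0 : 0 ≤ᵐ[P] v) :
    ∃ Q : Measure Ω, IsProbabilityMeasure Q ∧ Q ≪ P ∧
      xiBar F P Q t =ᵐ[P] condNormalize P (F t) v := by
  set ξ := condNormalize P (F t) v with hξ
  have hi : Integrable ξ P := integrable_condNormalize hm hv hv0
  have hξ0 : 0 ≤ᵐ[P] ξ := condNormalize_nonneg hv0
  have h1 : ∫ ω, ξ ω ∂P = 1 := by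
    rw [← integral_condExp hm, integral_congr_ae (condExp_condNormalize hm hv hv0)]
    simp
  set Q := P.withDensity fun ω => ENNReal.ofReal (ξ ω) with hQ
  have hQp : IsProbabilityMeasure Q := ⟨by
    rw [hQ, withDensity_apply _ MeasurableSet.univ, Measure.restrict_univ,
      ← ofReal_integral_eq_lintegral_ofReal hi hξ0, h1, ENNReal.ofReal_one]⟩
  have hr : rnd P Q =ᵐ[P] ξ := by
    filter_upwards [Measure.rnDeriv_withDensity₀ P hi.aemeasurable.ennreal_ofReal, hξ0] with ω h h'
    rw [rnd, h, ENNReal.toReal_ofReal h']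
  refine ⟨Q, hQp, withDensity_absolutelyContinuous _ _, ?_⟩
  filter_upwards [hr, condExp_congr_ae (m := F t) hr, condExp_condNormalize hm hv hv0]
    with ω a1 a2 a3
  rw [← hξ] at a3
  simp [xiBar, a2, a3, a1]

end XiBar

theorem e1_nonneg {d : ℕ} (i : Fin d) : 0 ≤ e1 d i := by
  unfold e1
  split_ifs <;> norm_num

theorem e1_le_one {d : ℕ} (i : Fin d) : e1 d i ≤ 1 := by
  unfold e1
  split_ifs <;> norm_num

theorem dot_e1 {d : ℕ} {i₀ : Fin d} (hi₀ : (i₀ : ℕ) = 0) (x : Fin d → ℝ) :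
    dot x (e1 d) = x i₀ := by
  unfold dot
  rw [Finset.sum_eq_single i₀]
  · simp [e1, hi₀]
  · intro i _ hi
    have : (i : ℕ) ≠ 0 := fun h => hi (Fin.ext (h.trans hi₀.symm))
    simp [e1, this]
  · simp

section Dual
variable [m0 : MeasurableSpace Ω] {P : Measure Ω} {F : ℕ → MeasurableSpace Ω} {d T t : ℕ}

theorem mem_LinfD_iff (hT : F T = m0) {X : Ω → Fin d → ℝ} :
    X ∈ LinfD F d T ↔ X ∈ boundedMeasurable Ω (Fin d → ℝ) := by
  subst hT
  refine and_congr_right fun _ => ⟨?_, ?_⟩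
  · rintro ⟨C, hC⟩
    exact ⟨max C 0, fun ω => (pi_norm_le_iff_of_nonneg (le_max_right _ _)).2 fun i =>
      (hC ω i).trans (le_max_left _ _)⟩
  · rintro ⟨R, hR⟩
    exact ⟨R, fun ω i => (norm_le_pi_norm (X ω) i).trans (hR ω)⟩

theorem integrable_mul_of_mem {v : Ω → ℝ} (hv : Integrable v P) {X : Ω → Fin d → ℝ}
    (hX : X ∈ boundedMeasurable Ω (Fin d → ℝ)) (i : Fin d) :
    Integrable (fun ω => v ω * X ω i) P := by
  obtain ⟨hm, R, hR⟩ := hX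
  exact hv.mul_bdd ((measurable_pi_iff.1 hm i).aestronglyMeasurable)
    (Eventually.of_forall fun ω => (norm_le_pi_norm (X ω) i).trans (hR ω))

theorem integrable_dot {v : Ω → Fin d → ℝ} (hv : ∀ i, Integrable (fun ω => v ω i) P)
    {X : Ω → Fin d → ℝ} (hX : X ∈ boundedMeasurable Ω (Fin d → ℝ)) :
    Integrable (fun ω => dot (v ω) (X ω)) P :=
  integrable_finsetSum _ fun i _ => integrable_mul_of_mem (hv i) hX i

/-- The random vector `w_t^T(Q, e₁ + m_⊥)`. -/
def dualDensity (F : ℕ → MeasurableSpace Ω) (P : Measure Ω) (t : ℕ) (Qv : Fin d → Measure Ω)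
    (mp : Ω → Fin d → ℝ) : Ω → Fin d → ℝ :=
  fun ω i => (e1 d i + mp ω i) * xiBar F P (Qv i) t ω

variable [IsProbabilityMeasure P] {K : ℕ → Ω → Set (Fin d → ℝ)} {Qv : Fin d → Measure Ω}
  {mp : Ω → Fin d → ℝ}

theorem memWte1.sum_EQcond (hm : F t ≤ m0) (h : memWte1 F P d T K t Qv mp) {X : Ω → Fin d → ℝ}
    (hX : X ∈ boundedMeasurable Ω (Fin d → ℝ)) :
    (fun ω => ∑ i : Fin d, (e1 d i + mp ω i) * EQcond F P (Qv i) t (fun ω' => X ω' i) ω) =ᵐ[P]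
      P[fun ω => dot (dualDensity F P t Qv mp ω) (X ω)|F t] := by
  have hint : ∀ i, Integrable (fun ω => dualDensity F P t Qv mp ω i * X ω i) P := fun i =>
    integrable_mul_of_mem (h.2.2.2.2.2.1 i).1 hX i
  have h1 : ∀ i : Fin d, P[fun ω => dualDensity F P t Qv mp ω i * X ω i|F t] =ᵐ[P]
      fun ω => (e1 d i + mp ω i) * EQcond F P (Qv i) t (fun ω' => X ω' i) ω := fun i => by
    have := (h.1 i).1
    have hs : StronglyMeasurable[F t] fun ω => e1 d i + mp ω i :=
      (Measurable.const_add (h.2.2.1 i).1 _).stronglyMeasurable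
    have he : (fun ω => dualDensity F P t Qv mp ω i * X ω i) =
        (fun ω => e1 d i + mp ω i) * fun ω => xiBar F P (Qv i) t ω * X ω i := by
      funext ω
      simp only [dualDensity, Pi.mul_apply, mul_assoc]
    have hint' := hint i
    rw [he] at hint' ⊢
    exact condExp_mul_of_stronglyMeasurable_left hs hint'
      (integrable_mul_of_mem (integrable_xiBar hm) hX i)
  have h2 : (fun ω => dot (dualDensity F P t Qv mp ω) (X ω)) =
      ∑ i : Fin d, fun ω => dualDensity F P t Qv mp ω i * X ω i := by
    funext ω
    simp [dot]
  rw [h2]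
  filter_upwards [condExp_finsetSum (fun i (_ : i ∈ Finset.univ) => hint i) (F t),
    ae_all_iff.2 h1] with ω a1 a2
  rw [a1, Finset.sum_apply]
  exact (Finset.sum_congr rfl fun i _ => a2 i).symm

theorem memWte1.condExp_dualDensity_zero (hm : F t ≤ m0) (h : memWte1 F P d T K t Qv mp)
    {i : Fin d} (hi : (i : ℕ) = 0) :
    P[fun ω => dualDensity F P t Qv mp ω i|F t] =ᵐ[P] fun _ => 1 := by
  have := (h.1 i).1
  have he : (fun ω => dualDensity F P t Qv mp ω i) = xiBar F P (Qv i) t := by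
    funext ω
    simp [dualDensity, e1, hi, h.2.1 ω i hi]
  rw [he]
  exact condExp_xiBar hm

/-- Every nonnegative, conditionally normalized element of `𝕂_t^+` comes from a dual pair. -/
theorem exists_memWte1 (hm : F t ≤ m0) {v : Ω → Fin d → ℝ}
    (hv : ∀ i, Integrable (fun ω => v ω i) P) (hv0 : ∀ i, ∀ᵐ ω ∂P, 0 ≤ v ω i) {i₀ : Fin d}
    (hi₀ : (i₀ : ℕ) = 0) (hv1 : P[fun ω => v ω i₀|F t] =ᵐ[P] fun _ => 1)
    (hK : ∀ u ∈ KK F d T K t, 0 ≤ ∫ ω, dot (v ω) (u ω) ∂P) :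
    ∃ Qv mp, memWte1 F P d T K t Qv mp ∧ dualDensity F P t Qv mp =ᵐ[P] v := by
  choose Qv hQp hQa hQx using fun i => exists_measure_xiBar_eq hm (hv i) (hv0 i)
  set mp : Ω → Fin d → ℝ := fun ω i =>
    if (i : ℕ) = 0 then 0 else max ((P[fun ω => v ω i|F t]) ω) 0 with hmp
  have hi₀' : ∀ i : Fin d, (i : ℕ) = 0 → i = i₀ := fun i hi => Fin.ext (hi.trans hi₀.symm)
  have hmp0 : ∀ ω i, 0 ≤ mp ω i := fun ω i => by
    simp only [hmp]
    split_ifs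
    exacts [le_rfl, le_max_right _ _]
  have hw0 : ∀ ω i, 0 ≤ e1 d i + mp ω i := fun ω i => add_nonneg (e1_nonneg i) (hmp0 ω i)
  have hcomp : ∀ i, (fun ω => dualDensity F P t Qv mp ω i) =ᵐ[P] fun ω => v ω i := fun i => by
    filter_upwards [hQx i, max_condExp_mul_condNormalize hm (hv i) (hv0 i), hv1] with ω a1 a2 a3
    rw [dualDensity, a1]
    refine Eq.trans ?_ a2
    congr 1
    by_cases hi : (i : ℕ) = 0
    · simp only [e1, hmp, hi, if_true]
      rw [hi₀' i hi, a3]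
      norm_num
    · simp [e1, hmp, hi]
  have hall : dualDensity F P t Qv mp =ᵐ[P] v := by
    filter_upwards [ae_all_iff.2 hcomp] with ω hω
    exact funext hω
  refine ⟨Qv, mp, ⟨fun i => ⟨hQp i, hQa i⟩, fun ω i hi => by simp [hmp, hi], fun i => ?_, ?_, ?_,
    fun i => ⟨(hv i).congr (hcomp i).symm, fun ω => mul_nonneg (hw0 ω i) (xiBar_nonneg t ω)⟩,
    fun i => (hv i).congr (hcomp i).symm, fun u hu => ?_⟩, hall⟩
  · by_cases hi : (i : ℕ) = 0
    · simp only [hmp, hi, if_true, le_refl, implies_true, and_true]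
      exact ⟨measurable_const, integrable_const _⟩
    · simp only [hmp, hi, if_false]
      exact ⟨stronglyMeasurable_condExp.measurable.max measurable_const,
        integrable_condExp.pos_part, fun ω => le_max_right _ _⟩
  · intro u hu
    exact integral_nonneg fun ω => Finset.sum_nonneg fun i _ => mul_nonneg (hw0 ω i) (hu.2 ω i)
  · intro h
    have h1 := h (fun _ => e1 d) ⟨⟨measurable_const, 1, fun ω i =>
      (abs_of_nonneg (e1_nonneg i)).trans_le (e1_le_one i)⟩, fun ω i hi => by simp [e1, hi]⟩
    have h2 : ∀ ω, dot (fun i => e1 d i + mp ω i) (e1 d) = 1 := fun ω => by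
      rw [dot_e1 hi₀]
      simp [e1, hi₀, hmp]
    simp [h2] at h1
  · refine (hK u hu).trans_eq (integral_congr_ae ?_)
    filter_upwards [hall] with ω hω
    exact congrArg (dot · (u ω)) hω.symm

end Dual

section DotIntegral
variable [MeasurableSpace Ω] {P : Measure Ω} {d : ℕ} {v U V : Ω → Fin d → ℝ}

theorem dot_add_right (x y z : Fin d → ℝ) : dot x (y + z) = dot x y + dot x z :=
  dotProduct_add x y z

theorem dot_smul_right (c : ℝ) (x y : Fin d → ℝ) : dot x (c • y) = c * dot x y :=
  dotProduct_smul c x y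

theorem dot_neg_right (x y : Fin d → ℝ) : dot x (-y) = -dot x y := dotProduct_neg x y

theorem dot_sub_right (x y z : Fin d → ℝ) : dot x (y - z) = dot x y - dot x z :=
  dotProduct_sub x y z

theorem dot_smul_left (c : ℝ) (x y : Fin d → ℝ) : dot (c • x) y = c * dot x y :=
  smul_dotProduct c x y

theorem integral_dot_add (hv : ∀ i, Integrable (fun ω => v ω i) P)
    (hU : U ∈ boundedMeasurable Ω (Fin d → ℝ)) (hV : V ∈ boundedMeasurable Ω (Fin d → ℝ)) :
    ∫ ω, dot (v ω) (U ω + V ω) ∂P = ∫ ω, dot (v ω) (U ω) ∂P + ∫ ω, dot (v ω) (V ω) ∂P := by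
  simp only [dot_add_right]
  exact integral_add (integrable_dot hv hU) (integrable_dot hv hV)

theorem integral_dot_sub (hv : ∀ i, Integrable (fun ω => v ω i) P)
    (hU : U ∈ boundedMeasurable Ω (Fin d → ℝ)) (hV : V ∈ boundedMeasurable Ω (Fin d → ℝ)) :
    ∫ ω, dot (v ω) (U ω - V ω) ∂P = ∫ ω, dot (v ω) (U ω) ∂P - ∫ ω, dot (v ω) (V ω) ∂P := by
  simp only [dot_sub_right]
  exact integral_sub (integrable_dot hv hU) (integrable_dot hv hV)

theorem integral_dot_smul (c : ℝ) :
    ∫ ω, dot (v ω) (c • U ω) ∂P = c * ∫ ω, dot (v ω) (U ω) ∂P := by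
  simp only [dot_smul_right, integral_const_mul]

end DotIntegral

theorem nonneg_of_forall_nat_mul_le {a b δ : ℝ} (h : ∀ n : ℕ, δ ≤ a + n * b) : 0 ≤ b := by
  by_contra! hb
  obtain ⟨n, hn⟩ := exists_nat_gt ((a - δ) / -b)
  rw [div_lt_iff₀ (by linarith)] at hn
  linarith [h n]

theorem const_mem_Linf {F : ℕ → MeasurableSpace Ω} {t : ℕ} (c : ℝ) : (fun _ => c) ∈ Linf F t :=
  ⟨measurable_const, |c|, fun _ => le_rfl⟩

section RiskMeasure
variable [m0 : MeasurableSpace Ω] {P : Measure Ω} {F : ℕ → MeasurableSpace Ω} {d T t : ℕ}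
  {rho : (Ω → Fin d → ℝ) → Ω → ℝ}

theorem smul_e1_mem {m : Ω → ℝ} (hFt : F t ≤ m0) (hm : m ∈ Linf F t) :
    (fun ω => m ω • e1 d) ∈ boundedMeasurable Ω (Fin d → ℝ) := by
  obtain ⟨hmm, C, hC⟩ := hm
  have hmm' : Measurable m := hmm.mono hFt le_rfl
  refine ⟨hmm'.smul_const _, C * ‖e1 d‖, fun ω => ?_⟩
  rw [norm_smul]
  exact mul_le_mul_of_nonneg_right (hC ω) (norm_nonneg _)

namespace ScalarRM

theorem integrable [IsFiniteMeasure P] (h : ScalarRM F P d T t rho) (hFil : FiltrationOK F P T)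
    {X : Ω → Fin d → ℝ} (hX : X ∈ boundedMeasurable Ω (Fin d → ℝ)) : Integrable (rho X) P := by
  obtain ⟨g, ⟨hgm, C, hC⟩, hg⟩ := h.finite X ((mem_LinfD_iff hFil.2.2.1).2 hX)
  exact (Integrable.of_bound (hgm.mono (hFil.2.1 t) le_rfl).aestronglyMeasurable C
    (Eventually.of_forall hC)).congr hg.symm

theorem cash_ae (h : ScalarRM F P d T t rho) (hFil : FiltrationOK F P T)
    {X : Ω → Fin d → ℝ} (hX : X ∈ boundedMeasurable Ω (Fin d → ℝ)) {m : Ω → ℝ}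
    (hm : m ∈ Linf F t) :
    rho (fun ω => X ω + m ω • e1 d) =ᵐ[P] fun ω => rho X ω - m ω :=
  h.cash X ((mem_LinfD_iff hFil.2.2.1).2 hX) m hm

theorem integral_cash [IsProbabilityMeasure P] (h : ScalarRM F P d T t rho)
    (hFil : FiltrationOK F P T) {X : Ω → Fin d → ℝ} (hX : X ∈ boundedMeasurable Ω (Fin d → ℝ))
    {m : Ω → ℝ} (hm : m ∈ Linf F t) :
    ∫ ω, rho (fun ω => X ω + m ω • e1 d) ω ∂P = ∫ ω, rho X ω ∂P - ∫ ω, m ω ∂P := by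
  obtain ⟨hmm, C, hC⟩ := id hm
  rw [integral_congr_ae (h.cash_ae hFil hX hm), integral_sub (h.integrable hFil hX)]
  exact Integrable.of_bound (hmm.mono (hFil.2.1 t) le_rfl).aestronglyMeasurable C
    (Eventually.of_forall hC)

theorem integral_cash_const [IsProbabilityMeasure P] (h : ScalarRM F P d T t rho)
    (hFil : FiltrationOK F P T) {X : Ω → Fin d → ℝ} (hX : X ∈ boundedMeasurable Ω (Fin d → ℝ))
    (c : ℝ) :
    ∫ ω, rho (fun ω => X ω + c • e1 d) ω ∂P = ∫ ω, rho X ω ∂P - c := by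
  simpa using h.integral_cash hFil hX (const_mem_Linf c)

theorem exists_zero_index [IsProbabilityMeasure P] (h : ScalarRM F P d T t rho)
    (hFil : FiltrationOK F P T) : ∃ i : Fin d, (i : ℕ) = 0 := by
  rcases Nat.eq_zero_or_pos d with rfl | hd
  · exfalso
    have h1 := h.integral_cash_const hFil (X := 0) (Submodule.zero_mem _) 1
    rw [Subsingleton.elim (fun ω => (0 : Ω → Fin 0 → ℝ) ω + (1 : ℝ) • e1 0) 0] at h1
    linarith
  · exact ⟨⟨0, hd⟩, rfl⟩

theorem integral_mono [IsFiniteMeasure P] (h : ScalarRM F P d T t rho)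
    (hFil : FiltrationOK F P T) {X Y : Ω → Fin d → ℝ} (hX : X ∈ boundedMeasurable Ω (Fin d → ℝ))
    (hY : Y ∈ boundedMeasurable Ω (Fin d → ℝ)) (hXY : ∀ ω i, X ω i ≤ Y ω i) :
    ∫ ω, rho Y ω ∂P ≤ ∫ ω, rho X ω ∂P :=
  integral_mono_ae (h.integrable hFil hY) (h.integrable hFil hX)
    (h.mono X ((mem_LinfD_iff hFil.2.2.1).2 hX) Y ((mem_LinfD_iff hFil.2.2.1).2 hY) hXY)

theorem exists_bound (h : ScalarRM F P d T t rho) (hFil : FiltrationOK F P T) (C : ℝ) :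
    ∃ R, ∀ X ∈ boundedMeasurable Ω (Fin d → ℝ), (∀ ω, ‖X ω‖ ≤ C) → ∀ᵐ ω ∂P, |rho X ω| ≤ R := by
  have hc : ∀ c : ℝ, (fun (_ : Ω) (_ : Fin d) => c) ∈ LinfD F d T := fun c =>
    ⟨measurable_const, |c|, fun _ _ => le_rfl⟩
  obtain ⟨g, ⟨-, A, hA⟩, hg⟩ := h.finite _ (hc C)
  obtain ⟨g', ⟨-, A', hA'⟩, hg'⟩ := h.finite _ (hc (-C))
  refine ⟨max A A', fun X hX hXC => ?_⟩
  have hX' := (mem_LinfD_iff hFil.2.2.1 (F := F)).2 hX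
  have hi : ∀ ω i, |X ω i| ≤ C := fun ω i => (norm_le_pi_norm (X ω) i).trans (hXC ω)
  filter_upwards [hg, hg', h.mono X hX' _ (hc C) fun ω i => (abs_le.1 (hi ω i)).2,
    h.mono _ (hc (-C)) X hX' fun ω i => (abs_le.1 (hi ω i)).1] with ω a1 a2 a3 a4
  rw [a1] at a3
  rw [a2] at a4
  have h1 := abs_le.1 (hA ω)
  have h2 := abs_le.1 (hA' ω)
  exact abs_le.2 ⟨by linarith [le_max_left A A'], by linarith [le_max_right A A']⟩

theorem integral_convex [IsProbabilityMeasure P] (h : ScalarRM F P d T t rho)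
    (hFil : FiltrationOK F P T) {X Y : Ω → Fin d → ℝ} (hX : X ∈ boundedMeasurable Ω (Fin d → ℝ))
    (hY : Y ∈ boundedMeasurable Ω (Fin d → ℝ)) {a b : ℝ} (ha : 0 ≤ a) (hb : 0 ≤ b)
    (hab : a + b = 1) :
    ∫ ω, rho (a • X + b • Y) ω ∂P ≤ a * ∫ ω, rho X ω ∂P + b * ∫ ω, rho Y ω ∂P := by
  obtain rfl : b = 1 - a := by linarith
  have h1 := h.convex X ((mem_LinfD_iff hFil.2.2.1).2 hX) Y ((mem_LinfD_iff hFil.2.2.1).2 hY)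
    (fun _ => a) (const_mem_Linf a) fun _ => ⟨ha, by linarith⟩
  rw [← integral_const_mul, ← integral_const_mul, ← integral_add
    ((h.integrable hFil hX).const_mul _) ((h.integrable hFil hY).const_mul _)]
  exact integral_mono_ae (h.integrable hFil (Submodule.add_mem _ (Submodule.smul_mem _ _ hX)
    (Submodule.smul_mem _ _ hY))) (((h.integrable hFil hX).const_mul _).add
      ((h.integrable hFil hY).const_mul _)) h1

end ScalarRM

theorem tendsto_posPart_of_le_liminf {x : ℕ → ℝ} {a R : ℝ} (hx : ∀ n, |x n| ≤ R)
    (ha : a ≤ liminf x atTop) : Tendsto (fun n => max (a - x n) 0) atTop (nhds 0) := by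
  rw [Metric.tendsto_atTop]
  intro ε hε
  have hb : IsBoundedUnder (· ≥ ·) atTop x := isBoundedUnder_of ⟨-R, fun n => (abs_le.1 (hx n)).1⟩
  have := eventually_lt_of_lt_liminf (show a - ε < liminf x atTop by linarith) hb
  obtain ⟨N, hN⟩ := eventually_atTop.1 this
  refine ⟨N, fun n hn => ?_⟩
  rw [Real.dist_eq, sub_zero, abs_of_nonneg (le_max_right _ _)]
  exact max_lt (by linarith [hN n hn]) hε

theorem Fatou.integral_le [IsProbabilityMeasure P] (hFat : Fatou F P d T rho)
    (h : ScalarRM F P d T t rho) (hFil : FiltrationOK F P T) {X : Ω → Fin d → ℝ}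
    (hX : X ∈ boundedMeasurable Ω (Fin d → ℝ)) {U : ℕ → Ω → Fin d → ℝ}
    (hU : ∀ n, U n ∈ boundedMeasurable Ω (Fin d → ℝ)) {C : ℝ} (hUC : ∀ n ω, ‖U n ω‖ ≤ C)
    (hlim : ∀ᵐ ω ∂P, Tendsto (fun n => U n ω) atTop (nhds (X ω))) {c : ℝ}
    (hc : ∀ n, ∫ ω, rho (U n) ω ∂P ≤ c) : ∫ ω, rho X ω ∂P ≤ c := by
  obtain ⟨R, hR⟩ := h.exists_bound hFil C
  have hUR : ∀ᵐ ω ∂P, ∀ n, |rho (U n) ω| ≤ R := ae_all_iff.2 fun n => hR _ (hU n) (hUC n)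
  have hliminf := hFat X ((mem_LinfD_iff hFil.2.2.1).2 hX) U
    (fun n => (mem_LinfD_iff hFil.2.2.1).2 (hU n))
    ⟨C, fun n ω i => (norm_le_pi_norm (U n ω) i).trans (hUC n ω)⟩ hlim
  have hXi := h.integrable hFil hX
  have hUi := fun n => h.integrable hFil (hU n)
  have hd : Tendsto (fun n => ∫ ω, max (rho X ω - rho (U n) ω) 0 ∂P) atTop (nhds 0) := by
    have := tendsto_integral_of_dominated_convergence (μ := P)
      (F := fun n ω => max (rho X ω - rho (U n) ω) 0) (f := fun _ => (0 : ℝ))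
      (fun ω => |rho X ω| + R) (fun n => (hXi.sub (hUi n)).pos_part.aestronglyMeasurable)
      (hXi.abs.add (integrable_const R)) (fun n => ?_) ?_
    · simpa using this
    · filter_upwards [hUR] with ω hω
      rw [Real.norm_of_nonneg (le_max_right _ _)]
      have h1 := abs_le.1 (hω n)
      have h2 := le_abs_self (rho X ω)
      exact max_le (by linarith)
        (by linarith [abs_nonneg (rho X ω), abs_nonneg (rho (U n) ω), hω n])
    · filter_upwards [hUR, hliminf] with ω h1 h2
      exact tendsto_posPart_of_le_liminf h1 h2
  have hle : ∀ n, ∫ ω, rho X ω ∂P - c ≤ ∫ ω, max (rho X ω - rho (U n) ω) 0 ∂P := fun n => by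
    have h1 := MeasureTheory.integral_mono (hXi.sub (hUi n)) (hXi.sub (hUi n)).pos_part
      fun ω => le_max_left _ _
    rw [integral_sub' hXi (hUi n)] at h1
    have h2 := hc n
    simp only [Pi.sub_apply] at h1
    linarith
  linarith [ge_of_tendsto' hd hle]

theorem Fatou.fatouClosedConvex [IsProbabilityMeasure P] (hFat : Fatou F P d T rho)
    (h : ScalarRM F P d T t rho) (hFil : FiltrationOK F P T) {X : Ω → Fin d → ℝ}
    (hX : X ∈ boundedMeasurable Ω (Fin d → ℝ)) (c : ℝ) :
    FatouClosedConvex P {U : Ω → Fin d → ℝ |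
      U ∈ boundedMeasurable Ω (Fin d → ℝ) ∧ ∫ ω, rho (X + U) ω ∂P ≤ c} where
  bdd U hU := hU.1
  convex := by
    rintro U ⟨hU, hUc⟩ V ⟨hV, hVc⟩ a b ha hb hab
    refine ⟨Submodule.add_mem _ (Submodule.smul_mem _ _ hU) (Submodule.smul_mem _ _ hV), ?_⟩
    have he : X + (a • U + b • V) = a • (X + U) + b • (X + V) := by
      calc X + (a • U + b • V) = (a + b) • X + (a • U + b • V) := by rw [hab, one_smul]
        _ = _ := by module
    rw [he]
    refine (h.integral_convex hFil (Submodule.add_mem _ hX hU) (Submodule.add_mem _ hX hV)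
      ha hb hab).trans ?_
    have h1 := mul_le_mul_of_nonneg_left hUc ha
    have h2 := mul_le_mul_of_nonneg_left hVc hb
    have h3 : a * c + b * c = c := by rw [← add_mul, hab, one_mul]
    linarith
  closed := by
    intro U V R hU hUR hV hVR hlim
    have hVB : V ∈ boundedMeasurable Ω (Fin d → ℝ) := ⟨hV, R, hVR⟩
    refine ⟨hVB, ?_⟩
    obtain ⟨C, hC⟩ := hX.2
    refine hFat.integral_le h hFil (Submodule.add_mem _ hX hVB) (U := fun n => X + U n)
      (fun n => Submodule.add_mem _ hX (hU n).1) (C := C + R)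
      (fun n ω => (norm_add_le _ _).trans (add_le_add (hC ω) (hUR n ω))) ?_ fun n => (hU n).2
    filter_upwards [hlim] with ω hω
    exact hω.const_add _

end RiskMeasure

theorem KK_smul {F : ℕ → MeasurableSpace Ω} {d T t : ℕ} {K : ℕ → Ω → Set (Fin d → ℝ)}
    (hK : ConesOK K) {k : Ω → Fin d → ℝ} (hk : k ∈ KK F d T K t) {c : ℝ} (hc : 0 ≤ c) :
    c • k ∈ KK F d T K t := by
  obtain ⟨κ, hκ, hk⟩ := hk
  refine ⟨fun s => c • κ s, fun s hs1 hs2 => ?_, fun ω => ?_⟩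
  · obtain ⟨⟨hm, C, hC⟩, hκK⟩ := hκ s hs1 hs2
    refine ⟨⟨Measurable.const_smul hm c, c * C, fun ω i => ?_⟩,
      fun ω => (hK s ω).2.2.2 c hc _ (hκK ω)⟩
    simp only [Pi.smul_apply, smul_eq_mul, abs_mul, abs_of_nonneg hc]
    exact mul_le_mul_of_nonneg_left (hC ω i) hc
  · simp only [Pi.smul_apply, hk, Finset.smul_sum]

section Separation
variable [m0 : MeasurableSpace Ω] {P : Measure Ω} {F : ℕ → MeasurableSpace Ω} {d T t : ℕ}
  {rho : (Ω → Fin d → ℝ) → Ω → ℝ} {K : ℕ → Ω → Set (Fin d → ℝ)}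

theorem KK_subset (hFil : FiltrationOK F P T) {k : Ω → Fin d → ℝ} (hk : k ∈ KK F d T K t) :
    k ∈ boundedMeasurable Ω (Fin d → ℝ) := by
  obtain ⟨κ, hκ, hk⟩ := hk
  have he : k = ∑ s ∈ Finset.Icc t T, κ s := by
    funext ω
    rw [hk, Finset.sum_apply]
  rw [he]
  refine Submodule.sum_mem _ fun s hs => ?_
  obtain ⟨hs1, hs2⟩ := Finset.mem_Icc.1 hs
  obtain ⟨⟨hm, hb⟩, -⟩ := hκ s hs1 hs2
  exact (mem_LinfD_iff hFil.2.2.1).1 ⟨hm.mono (hFil.1 s T hs2) le_rfl, hb⟩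

theorem ScalarRM.integral_add_KK_le [IsFiniteMeasure P] (h : ScalarRM F P d T t rho)
    (hFil : FiltrationOK F P T) (hKc : KCompat F P d T K t rho) {X k : Ω → Fin d → ℝ}
    (hX : X ∈ boundedMeasurable Ω (Fin d → ℝ)) (hk : k ∈ KK F d T K t) :
    ∫ ω, rho (X + k) ω ∂P ≤ ∫ ω, rho X ω ∂P := by
  have hXk := Submodule.add_mem _ hX (KK_subset hFil hk)
  refine integral_mono_ae (h.integrable hFil hXk) (h.integrable hFil hX)
    ((hKc (X + k) ((mem_LinfD_iff hFil.2.2.1).2 hXk)).1 _ ⟨k, hk, ?_⟩)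
  congr 1
  funext ω
  simp

theorem ae_nonneg_of_forall_indicator [IsFiniteMeasure P] {v : Ω → Fin d → ℝ}
    (hv : ∀ i, Integrable (fun ω => v ω i) P)
    (h : ∀ u ∈ boundedMeasurable Ω (Fin d → ℝ), (∀ ω i, 0 ≤ u ω i) →
      0 ≤ ∫ ω, dot (v ω) (u ω) ∂P) (i : Fin d) : ∀ᵐ ω ∂P, 0 ≤ v ω i := by
  refine ae_nonneg_of_forall_setIntegral_nonneg (hv i) fun A hA _ => ?_
  set u : Ω → Fin d → ℝ := fun ω => Pi.single i (A.indicator 1 ω) with hu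
  have hub : u ∈ boundedMeasurable Ω (Fin d → ℝ) := by
    refine ⟨measurable_pi_iff.2 fun j => ?_, 1, fun ω =>
      (pi_norm_le_iff_of_nonneg zero_le_one).2 fun j => ?_⟩
    · by_cases hj : j = i
      · subst hj
        simpa [hu] using Measurable.indicator measurable_one hA
      · simp [hu, Pi.single_eq_of_ne hj]
    · by_cases hj : j = i
      · subst hj
        by_cases hω : ω ∈ A <;> simp [hu, hω]
      · simp [hu, Pi.single_eq_of_ne hj]
  have h0 := h u hub fun ω j => by
    by_cases hj : j = i
    · subst hj
      by_cases hω : ω ∈ A <;> simp [hu, hω]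
    · simp [hu, Pi.single_eq_of_ne hj]
  have he : ∀ ω, dot (v ω) (u ω) = A.indicator (fun ω => v ω i) ω := fun ω => by
    refine (dotProduct_single _ _ _).trans ?_
    by_cases hω : ω ∈ A <;> simp [hω]
  simp only [he] at h0
  rwa [integral_indicator hA] at h0

/-- A functional that vanishes on the centered elements of `L^∞(F_t)` has a density with constant
conditional expectation. -/
theorem condExp_eq_const_of_forall_centered [IsProbabilityMeasure P] (hFt : F t ≤ m0) {v : Ω → ℝ}
    (hv : Integrable v P)
    (h : ∀ m ∈ Linf F t, ∫ ω, m ω ∂P = 0 → 0 ≤ ∫ ω, v ω * m ω ∂P) :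
    P[v|F t] =ᵐ[P] fun _ => ∫ ω, v ω ∂P := by
  refine (ae_eq_condExp_of_forall_setIntegral_eq hFt hv
    (fun s _ _ => (integrable_const _).integrableOn) (fun A hA _ => ?_)
    stronglyMeasurable_const.aestronglyMeasurable).symm
  have hA' := hFt _ hA
  set p : ℝ := P.real A with hp
  have hind : Integrable (A.indicator (1 : Ω → ℝ)) P := (integrable_const (1 : ℝ)).indicator hA'
  have hint : ∫ ω, A.indicator (1 : Ω → ℝ) ω ∂P = p := by
    rw [integral_indicator_one hA']
  have hvA : ∫ ω, v ω * A.indicator (1 : Ω → ℝ) ω ∂P = ∫ ω in A, v ω ∂P := by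
    rw [← integral_indicator hA']
    refine integral_congr_ae (Eventually.of_forall fun ω => ?_)
    by_cases hω : ω ∈ A <;> simp [hω]
  have hviA : Integrable (fun ω => v ω * A.indicator (1 : Ω → ℝ) ω) P :=
    hv.mul_bdd hind.1 (c := 1) (Eventually.of_forall fun ω => by
      by_cases hω : ω ∈ A <;> simp [hω])
  have hmem : ∀ σ : ℝ, (fun ω => σ * (A.indicator (1 : Ω → ℝ) ω - p)) ∈ Linf F t := fun σ => by
    refine ⟨Measurable.const_mul ((Measurable.indicator measurable_const hA).sub_const p) σ,
      |σ| * (1 + |p|), fun ω => ?_⟩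
    rw [abs_mul]
    refine mul_le_mul_of_nonneg_left ((abs_sub _ _).trans ?_) (abs_nonneg _)
    by_cases hω : ω ∈ A <;> simp [hω]
  have key : ∀ σ : ℝ, 0 ≤ σ * (∫ ω in A, v ω ∂P - (∫ ω, v ω ∂P) * p) := fun σ => by
    refine (h _ (hmem σ) ?_).trans_eq ?_
    · rw [integral_const_mul, integral_sub hind (integrable_const _), hint]
      simp
    · rw [← hvA, ← integral_mul_const, ← integral_sub hviA (hv.mul_const p), ← integral_const_mul]
      congr 1
      funext ω
      ring
  have h1 := key 1
  have h2 := key (-1)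
  rw [setIntegral_const, smul_eq_mul]
  change p * _ = _
  linarith

theorem Fatou.exists_subgradient [IsProbabilityMeasure P] (hFat : Fatou F P d T rho)
    (h : ScalarRM F P d T t rho) (hFil : FiltrationOK F P T) (hK : ConesOK K)
    (hKc : KCompat F P d T K t rho) {i₀ : Fin d} (hi₀ : (i₀ : ℕ) = 0) {X : Ω → Fin d → ℝ}
    (hX : X ∈ boundedMeasurable Ω (Fin d → ℝ)) {ε : ℝ} (hε : 0 < ε) :
    ∃ v : Ω → Fin d → ℝ, (∀ i, Integrable (fun ω => v ω i) P) ∧ (∀ i, ∀ᵐ ω ∂P, 0 ≤ v ω i) ∧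
      (P[fun ω => v ω i₀|F t] =ᵐ[P] fun _ => 1) ∧
      (∀ u ∈ KK F d T K t, 0 ≤ ∫ ω, dot (v ω) (u ω) ∂P) ∧
      ∀ Y ∈ boundedMeasurable Ω (Fin d → ℝ),
        ∫ ω, dot (v ω) (X ω) ∂P + ∫ ω, rho X ω ∂P - ε ≤
          ∫ ω, dot (v ω) (Y ω) ∂P + ∫ ω, rho Y ω ∂P := by
  have hFt := hFil.2.1 t
  set D := {U : Ω → Fin d → ℝ |
    U ∈ boundedMeasurable Ω (Fin d → ℝ) ∧ ∫ ω, rho (X + U) ω ∂P ≤ ∫ ω, rho X ω ∂P - ε} with hD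
  have hcB : ∀ c : ℝ, (fun _ : Ω => c • e1 d) ∈ boundedMeasurable Ω (Fin d → ℝ) := fun c =>
    smul_e1_mem hFt (const_mem_Linf c)
  have hXε : ∫ ω, rho (X + fun _ => ε • e1 d) ω ∂P = ∫ ω, rho X ω ∂P - ε :=
    h.integral_cash_const hFil hX ε
  have hεD : (fun _ => ε • e1 d) ∈ D := ⟨hcB ε, hXε.le⟩
  obtain ⟨v, hv, δ, hδ, hsep⟩ := (hFat.fatouClosedConvex h hFil hX _).exists_separating_density
    ⟨_, hεD⟩ (by
      rintro ⟨-, h0⟩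
      rw [add_zero] at h0
      linarith)
  have hdir : ∀ u ∈ boundedMeasurable Ω (Fin d → ℝ),
      (∀ n : ℕ, (fun _ => ε • e1 d) + (n : ℝ) • u ∈ D) → 0 ≤ ∫ ω, dot (v ω) (u ω) ∂P := by
    intro u hu hn
    refine nonneg_of_forall_nat_mul_le (a := ∫ ω, dot (v ω) (ε • e1 d) ∂P) (δ := δ) fun n => ?_
    have h1 := hsep _ (hn n)
    have h2 := integral_dot_add hv (hcB ε) (Submodule.smul_mem _ (n : ℝ) hu)
    have h3 := integral_dot_smul (P := P) (v := v) (U := u) (n : ℝ)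
    simp only [Pi.add_apply, Pi.smul_apply] at h1 h2
    linarith
  have hdotm : ∀ m : Ω → ℝ, ∀ ω, dot (v ω) (m ω • e1 d) = v ω i₀ * m ω := fun m ω => by
    rw [dot_smul_right, dot_e1 hi₀, mul_comm]
  have hKv : ∀ u ∈ KK F d T K t, 0 ≤ ∫ ω, dot (v ω) (u ω) ∂P := fun u hu => by
    refine hdir u (KK_subset hFil hu) fun n =>
      ⟨Submodule.add_mem _ (hcB ε) (Submodule.smul_mem _ _ (KK_subset hFil hu)), ?_⟩
    rw [← hXε, ← add_assoc]
    exact h.integral_add_KK_le hFil hKc (Submodule.add_mem _ hX (hcB ε))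
      (KK_smul hK hu n.cast_nonneg)
  have hpos : ∀ i, ∀ᵐ ω ∂P, 0 ≤ v ω i := by
    refine ae_nonneg_of_forall_indicator hv fun u hu hu0 => hdir u hu fun n =>
      ⟨Submodule.add_mem _ (hcB ε) (Submodule.smul_mem _ _ hu), ?_⟩
    rw [← hXε, ← add_assoc]
    refine h.integral_mono hFil (Submodule.add_mem _ hX (hcB ε))
      (Submodule.add_mem _ (Submodule.add_mem _ hX (hcB ε)) (Submodule.smul_mem _ _ hu))
      fun ω i => ?_
    have := mul_nonneg n.cast_nonneg (hu0 ω i) (α := ℝ)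
    simpa using this
  set c := ∫ ω, v ω i₀ ∂P with hc
  have hce : P[fun ω => v ω i₀|F t] =ᵐ[P] fun _ => c := by
    refine condExp_eq_const_of_forall_centered hFt (hv i₀) fun m hm hm0 => ?_
    refine (hdir _ (smul_e1_mem hFt hm) fun n => ⟨Submodule.add_mem _ (hcB ε)
      (Submodule.smul_mem _ _ (smul_e1_mem hFt hm)), ?_⟩).trans_eq ?_
    · rw [← hXε, ← add_assoc]
      have hnm : (fun ω => (n : ℝ) * m ω) ∈ Linf F t := by
        obtain ⟨hmm, C, hC⟩ := hm
        refine ⟨Measurable.const_mul hmm _, n * C, fun ω => ?_⟩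
        rw [abs_mul, Nat.abs_cast]
        exact mul_le_mul_of_nonneg_left (hC ω) n.cast_nonneg
      have h1 := h.integral_cash hFil (Submodule.add_mem _ hX (hcB ε)) hnm
      rw [integral_const_mul, hm0, mul_zero, sub_zero] at h1
      refine (Eq.trans ?_ h1).le
      have he : X + (fun _ => ε • e1 d) + (n : ℝ) • (fun ω => m ω • e1 d) =
          fun ω => (X + fun _ => ε • e1 d : Ω → Fin d → ℝ) ω + ((n : ℝ) * m ω) • e1 d := by
        funext ω
        simp [mul_smul]
      rw [he]
    · simp only [hdotm]
  have hcpos : 0 < c := by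
    have h1 := hsep _ hεD
    have h2 : ∫ ω, dot (v ω) (ε • e1 d) ∂P = c * ε := by
      rw [hc, ← integral_mul_const]
      simp only [hdotm fun _ => ε]
    rw [h2] at h1
    exact pos_of_mul_pos_left (hδ.trans_le h1) hε.le
  refine ⟨fun ω => c⁻¹ • v ω, fun i => (hv i).const_mul c⁻¹, fun i => ?_, ?_, fun u hu => ?_,
    fun Y hY => ?_⟩
  · filter_upwards [hpos i] with ω hω
    exact mul_nonneg (inv_nonneg.2 hcpos.le) hω
  · filter_upwards [condExp_smul (μ := P) c⁻¹ (fun ω => v ω i₀) (F t), hce] with ω a1 a2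
    refine a1.trans ?_
    rw [Pi.smul_apply, a2, smul_eq_mul, inv_mul_cancel₀ hcpos.ne']
  · simp only [dot_smul_left, integral_const_mul]
    exact mul_nonneg (inv_nonneg.2 hcpos.le) (hKv u hu)
  · set a := ∫ ω, rho Y ω ∂P - ∫ ω, rho X ω ∂P + ε with ha
    have hYX : Y - X ∈ boundedMeasurable Ω (Fin d → ℝ) := Submodule.sub_mem _ hY hX
    have h1 := hsep ((Y - X) + fun _ => a • e1 d) ⟨Submodule.add_mem _ hYX (hcB a), by
      rw [← add_assoc, add_sub_cancel]
      refine (h.integral_cash_const hFil hY a).le.trans ?_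
      rw [ha]
      linarith⟩
    have h2 := integral_dot_add hv hYX (hcB a)
    have h3 := integral_dot_sub hv hY hX
    have h4 : ∫ ω, dot (v ω) (a • e1 d) ∂P = c * a := by
      rw [hc, ← integral_mul_const]
      simp only [hdotm fun _ => a]
    simp only [Pi.add_apply, Pi.sub_apply] at h1 h2
    simp only [dot_smul_left, integral_const_mul]
    have h5 : 0 ≤ c⁻¹ * (∫ ω, dot (v ω) (Y ω) ∂P - ∫ ω, dot (v ω) (X ω) ∂P + c * a) :=
      mul_nonneg (inv_nonneg.2 hcpos.le) (by linarith)
    rw [mul_add, mul_sub, inv_mul_cancel_left₀ hcpos.ne'] at h5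
    rw [ha] at h5
    linarith

end Separation

section Representation
variable [m0 : MeasurableSpace Ω] {P : Measure Ω} {F : ℕ → MeasurableSpace Ω} {d T t : ℕ}
  {rho : (Ω → Fin d → ℝ) → Ω → ℝ} {K : ℕ → Ω → Set (Fin d → ℝ)} {Qv : Fin d → Measure Ω}
  {mp : Ω → Fin d → ℝ}

theorem Acc.mem (hFil : FiltrationOK F P T) {Z : Ω → Fin d → ℝ} (hZ : Z ∈ Acc F P d T rho) :
    Z ∈ boundedMeasurable Ω (Fin d → ℝ) := (mem_LinfD_iff hFil.2.2.1).1 hZ.1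

/-- Every position is made acceptable by adding its capital requirement. -/
theorem ScalarRM.exists_add_smul_e1_mem_Acc (h : ScalarRM F P d T t rho)
    (hFil : FiltrationOK F P T) {X : Ω → Fin d → ℝ} (hX : X ∈ boundedMeasurable Ω (Fin d → ℝ)) :
    ∃ m ∈ Linf F t, rho X =ᵐ[P] m ∧ (fun ω => X ω + m ω • e1 d) ∈ Acc F P d T rho := by
  obtain ⟨m, hm, hXm⟩ := h.finite X ((mem_LinfD_iff hFil.2.2.1).2 hX)
  refine ⟨m, hm, hXm, (mem_LinfD_iff hFil.2.2.1).2
    (Submodule.add_mem _ hX (smul_e1_mem (hFil.2.1 t) hm)), ?_⟩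
  filter_upwards [h.cash_ae hFil hX hm, hXm] with ω h1 h2
  rw [h1, h2, sub_self]

/-- The conditional expectations `E[-vᵀZ | F_t]` of acceptable positions are upward directed. -/
theorem ScalarRM.directed_condExp_Acc (h : ScalarRM F P d T t rho) (hFil : FiltrationOK F P T)
    {v : Ω → Fin d → ℝ} (hv : ∀ i, Integrable (fun ω => v ω i) P) {Z₁ Z₂ : Ω → Fin d → ℝ}
    (hZ₁ : Z₁ ∈ Acc F P d T rho) (hZ₂ : Z₂ ∈ Acc F P d T rho) :
    ∃ Z ∈ Acc F P d T rho,
      P[fun ω => dot (v ω) (-Z₁ ω)|F t] ≤ᵐ[P] P[fun ω => dot (v ω) (-Z ω)|F t] ∧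
      P[fun ω => dot (v ω) (-Z₂ ω)|F t] ≤ᵐ[P] P[fun ω => dot (v ω) (-Z ω)|F t] := by
  have hFt := hFil.2.1 t
  have hB₁ := Acc.mem hFil hZ₁
  have hB₂ := Acc.mem hFil hZ₂
  set E₁ := P[fun ω => dot (v ω) (-Z₁ ω)|F t] with hE₁
  set E₂ := P[fun ω => dot (v ω) (-Z₂ ω)|F t] with hE₂
  have hA : MeasurableSet[F t] {ω | E₂ ω ≤ E₁ ω} :=
    measurableSet_le stronglyMeasurable_condExp.measurable stronglyMeasurable_condExp.measurable
  set lam : Ω → ℝ := {ω | E₂ ω ≤ E₁ ω}.indicator 1 with hlam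
  have hl : ∀ ω, E₂ ω ≤ E₁ ω → lam ω = 1 := fun ω hω => indicator_of_mem (by exact hω) _
  have hl' : ∀ ω, ¬E₂ ω ≤ E₁ ω → lam ω = 0 := fun ω hω => indicator_of_notMem (by exact hω) _
  have hlm : Measurable[F t] lam := Measurable.indicator measurable_const hA
  have hl01 : ∀ ω, lam ω ∈ Icc (0 : ℝ) 1 := fun ω => by
    by_cases hω : E₂ ω ≤ E₁ ω
    · simp [hl ω hω]
    · simp [hl' ω hω]
  have hlL : lam ∈ Linf F t := ⟨hlm, 1, fun ω => abs_le.2 ⟨by linarith [(hl01 ω).1], (hl01 ω).2⟩⟩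
  set Z : Ω → Fin d → ℝ := fun ω => lam ω • Z₁ ω + (1 - lam ω) • Z₂ ω with hZdef
  have hZB : Z ∈ boundedMeasurable Ω (Fin d → ℝ) := by
    have hlm' := hlm.mono hFt le_rfl
    obtain ⟨R₁, hR₁⟩ := hB₁.2
    obtain ⟨R₂, hR₂⟩ := hB₂.2
    refine ⟨(hlm'.smul hB₁.1).add ((hlm'.const_sub 1).smul hB₂.1), max R₁ R₂, fun ω => ?_⟩
    by_cases hω : E₂ ω ≤ E₁ ω
    · simpa [hZdef, hl ω hω] using Or.inl (hR₁ ω)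
    · simpa [hZdef, hl' ω hω] using Or.inr (hR₂ ω)
  have hZA : Z ∈ Acc F P d T rho := by
    refine ⟨(mem_LinfD_iff hFil.2.2.1).2 hZB, ?_⟩
    filter_upwards [h.convex Z₁ hZ₁.1 Z₂ hZ₂.1 lam hlL hl01, hZ₁.2, hZ₂.2] with ω h1 h2 h3
    have h4 := hl01 ω
    exact h1.trans (add_nonpos (mul_nonpos_of_nonneg_of_nonpos h4.1 h2)
      (mul_nonpos_of_nonneg_of_nonpos (by linarith [h4.2]) h3))
  have hi₁ := integrable_dot hv (Submodule.neg_mem _ hB₁)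
  have hi₂ := integrable_dot hv (Submodule.neg_mem _ hB₂)
  have hlb : ∀ ω, ‖lam ω‖ ≤ 1 := fun ω => by
    rw [Real.norm_of_nonneg (hl01 ω).1]
    exact (hl01 ω).2
  have hlb' : ∀ ω, ‖1 - lam ω‖ ≤ 1 := fun ω => by
    rw [Real.norm_of_nonneg (by linarith [(hl01 ω).2])]
    linarith [(hl01 ω).1]
  have hp₁ : Integrable (lam * fun ω => dot (v ω) (-Z₁ ω)) P :=
    hi₁.bdd_mul (hlm.mono hFt le_rfl).aestronglyMeasurable (Eventually.of_forall hlb)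
  have hp₂ : Integrable ((fun ω => 1 - lam ω) * fun ω => dot (v ω) (-Z₂ ω)) P :=
    hi₂.bdd_mul ((hlm.mono hFt le_rfl).const_sub 1).aestronglyMeasurable (Eventually.of_forall hlb')
  have he : (fun ω => dot (v ω) (-Z ω)) = (lam * fun ω => dot (v ω) (-Z₁ ω)) +
      (fun ω => 1 - lam ω) * fun ω => dot (v ω) (-Z₂ ω) := by
    funext ω
    simp only [hZdef, dot_neg_right, dot_add_right, dot_smul_right, Pi.add_apply, Pi.mul_apply]
    ring
  have hmain : P[fun ω => dot (v ω) (-Z ω)|F t] =ᵐ[P]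
      fun ω => lam ω * E₁ ω + (1 - lam ω) * E₂ ω := by
    rw [he]
    filter_upwards [condExp_add hp₁ hp₂ (F t),
      condExp_mul_of_stronglyMeasurable_left hlm.stronglyMeasurable hp₁ hi₁,
      condExp_mul_of_stronglyMeasurable_left (hlm.const_sub 1).stronglyMeasurable hp₂ hi₂]
      with ω a1 a2 a3
    rw [a1, Pi.add_apply, a2, a3]
    rfl
  refine ⟨Z, hZA, ?_, ?_⟩
  all_goals
    filter_upwards [hmain] with ω hω
    rw [hω]
    by_cases hc : E₂ ω ≤ E₁ ω
    · rw [hl ω hc]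
      linarith
    · rw [hl' ω hc]
      linarith

/-- A sequence of lower bounds whose means approach the mean of `f` determines `f` from below. -/
theorem ae_le_of_forall_integral_ge {f : Ω → ℝ} (hf : Integrable f P)
    {h : Ω → EReal} (hn : ∀ ε > 0, ∃ g : Ω → ℝ, Integrable g P ∧ g ≤ᵐ[P] f ∧
      ∫ ω, f ω ∂P - ε ≤ ∫ ω, g ω ∂P ∧ ∀ᵐ ω ∂P, (g ω : EReal) ≤ h ω) :
    ∀ᵐ ω ∂P, (f ω : EReal) ≤ h ω := by
  choose g hgi hgf hgε hgh using fun n : ℕ => hn (1 / ((n : ℝ) + 1)) (by positivity)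
  have hgf' := ae_all_iff.2 hgf
  have hdi := fun n => hf.sub (hgi n)
  set L : Ω → ℝ := fun ω => ⨅ n, (f ω - g n ω) with hL
  have hbb : ∀ᵐ ω ∂P, BddBelow (range fun n => f ω - g n ω) := by
    filter_upwards [hgf'] with ω hω
    exact ⟨0, by rintro _ ⟨k, rfl⟩; exact sub_nonneg.2 (hω k)⟩
  have hL0 : 0 ≤ᵐ[P] L := by
    filter_upwards [hgf'] with ω hω
    exact le_ciInf fun k => sub_nonneg.2 (hω k)
  have hLle : ∀ n, L ≤ᵐ[P] fun ω => f ω - g n ω := fun n => by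
    filter_upwards [hbb] with ω hω
    exact ciInf_le hω n
  have hLi : Integrable L P := by
    refine (hdi 0).mono' (AEMeasurable.iInf fun n => (hdi n).aemeasurable).aestronglyMeasurable ?_
    filter_upwards [hL0, hLle 0] with ω h0 h1
    rwa [Real.norm_of_nonneg h0]
  have hLz : L =ᵐ[P] 0 := by
    rw [← integral_eq_zero_iff_of_nonneg_ae hL0 hLi]
    refine le_antisymm (ge_of_tendsto' tendsto_one_div_add_atTop_nhds_zero_nat fun n => ?_)
      (integral_nonneg_of_ae hL0)
    have h1 := integral_mono_ae hLi (hdi n) (hLle n)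
    rw [integral_sub' hf (hgi n)] at h1
    linarith [hgε n]
  filter_upwards [hLz, ae_all_iff.2 hgh] with ω h1 h2
  by_contra! hlt
  obtain ⟨r, hr1, hr2⟩ := EReal.lt_iff_exists_real_btwn.1 hlt
  rw [EReal.coe_lt_coe_iff] at hr2
  have h3 : (⨅ n, (f ω - g n ω)) < f ω - r := by
    have : (⨅ n, (f ω - g n ω)) = 0 := h1
    rw [this]
    linarith
  obtain ⟨n, hn⟩ := exists_lt_of_ciInf_lt h3
  have h4 : (r : EReal) < (g n ω : EReal) := EReal.coe_lt_coe_iff.2 (by linarith)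
  exact absurd (h2 n) (not_le.2 (hr1.trans h4))

variable [IsProbabilityMeasure P]

theorem memWte1.condExp_dot_add_smul_e1 (hFt : F t ≤ m0) (hW : memWte1 F P d T K t Qv mp)
    {i₀ : Fin d} (hi₀ : (i₀ : ℕ) = 0) {X : Ω → Fin d → ℝ}
    (hX : X ∈ boundedMeasurable Ω (Fin d → ℝ)) {m : Ω → ℝ} (hm : m ∈ Linf F t) :
    P[fun ω => dot (dualDensity F P t Qv mp ω) (-(X ω + m ω • e1 d))|F t] =ᵐ[P]
      fun ω => -(P[fun ω => dot (dualDensity F P t Qv mp ω) (X ω)|F t]) ω - m ω := by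
  set v := dualDensity F P t Qv mp with hvdef
  have hv : ∀ i, Integrable (fun ω => v ω i) P := fun i => (hW.2.2.2.2.2.1 i).1
  have he : (fun ω => dot (v ω) (-(X ω + m ω • e1 d))) =
      -((fun ω => dot (v ω) (X ω)) + m * fun ω => v ω i₀) := by
    funext ω
    simp [dot_neg_right, dot_add_right, dot_smul_right, dot_e1 hi₀]
  have hmv : Integrable (m * fun ω => v ω i₀) P := by
    obtain ⟨hmm, C, hC⟩ := hm
    exact (hv i₀).bdd_mul (hmm.mono hFt le_rfl).aestronglyMeasurable (Eventually.of_forall hC)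
  rw [he]
  filter_upwards [condExp_neg ((fun ω => dot (v ω) (X ω)) + m * fun ω => v ω i₀) (F t),
    condExp_add (integrable_dot hv hX) hmv (F t),
    condExp_mul_of_stronglyMeasurable_left hm.1.stronglyMeasurable hmv (hv i₀),
    hW.condExp_dualDensity_zero hFt hi₀] with ω a1 a2 a3 a4
  rw [a1, Pi.neg_apply, a2, Pi.add_apply, a3, Pi.mul_apply]
  rw [← hvdef] at a4
  rw [a4]
  ring

/-- Every dual pair bounds the risk measure from below. -/
theorem ScalarRM.neg_alpha_sub_le (h : ScalarRM F P d T t rho) (hFil : FiltrationOK F P T)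
    (hW : memWte1 F P d T K t Qv mp) {a : Ω → EReal}
    (ha : ∀ Z ∈ Acc F P d T rho, ∀ᵐ ω ∂P, ((∑ i : Fin d, (e1 d i + mp ω i) *
      EQcond F P (Qv i) t (fun ω' => -Z ω' i) ω : ℝ) : EReal) ≤ a ω)
    {X : Ω → Fin d → ℝ} (hX : X ∈ boundedMeasurable Ω (Fin d → ℝ)) :
    ∀ᵐ ω ∂P, -a ω - ((∑ i : Fin d, (e1 d i + mp ω i) *
      EQcond F P (Qv i) t (fun ω' => X ω' i) ω : ℝ) : EReal) ≤ (rho X ω : EReal) := by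
  have hFt := hFil.2.1 t
  obtain ⟨i₀, hi₀⟩ := h.exists_zero_index hFil
  obtain ⟨m, hm, hXm, hZ⟩ := h.exists_add_smul_e1_mem_Acc hFil hX
  filter_upwards [ha _ hZ, hW.sum_EQcond hFt (Submodule.neg_mem _ (Acc.mem hFil hZ)),
    hW.sum_EQcond hFt hX, hW.condExp_dot_add_smul_e1 hFt hi₀ hX hm, hXm] with ω a1 a2 a3 a4 a5
  have a2' : (∑ i : Fin d, (e1 d i + mp ω i) *
      EQcond F P (Qv i) t (fun ω' => -(X ω' + m ω' • e1 d) i) ω) = _ := a2.trans a4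
  rw [a2', ← a5, ← a3] at a1
  set E := ∑ i : Fin d, (e1 d i + mp ω i) * EQcond F P (Qv i) t (fun ω' => X ω' i) ω
  calc -a ω - (E : EReal) ≤ -((-E - rho X ω : ℝ) : EReal) - (E : EReal) :=
        EReal.sub_le_sub (EReal.neg_le_neg_iff.2 a1) le_rfl
    _ = (rho X ω : EReal) := by
        rw [← EReal.coe_neg, ← EReal.coe_sub]
        congr 1
        ring

end Representation

section Existence
variable [m0 : MeasurableSpace Ω] {P : Measure Ω} {F : ℕ → MeasurableSpace Ω} {d T t : ℕ}
  {rho : (Ω → Fin d → ℝ) → Ω → ℝ} {K : ℕ → Ω → Set (Fin d → ℝ)} {Qv : Fin d → Measure Ω}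
  {mp : Ω → Fin d → ℝ}

theorem memWte1.integrable_dualDensity (hW : memWte1 F P d T K t Qv mp) (i : Fin d) :
    Integrable (fun ω => dualDensity F P t Qv mp ω i) P := (hW.2.2.2.2.2.1 i).1

theorem Acc.integral_nonpos {Z : Ω → Fin d → ℝ} (hZ : Z ∈ Acc F P d T rho) :
    ∫ ω, rho Z ω ∂P ≤ 0 := integral_nonpos_of_ae hZ.2

theorem CoherentRM.zero_ae (hcoh : CoherentRM F P d T t rho) (hFil : FiltrationOK F P T) :
    rho 0 =ᵐ[P] 0 := by
  have h0 : (0 : Ω → Fin d → ℝ) ∈ LinfD F d T :=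
    (mem_LinfD_iff hFil.2.2.1).2 (Submodule.zero_mem _)
  have h1 := hcoh 0 h0 0 (const_mem_Linf 0) fun _ => le_rfl
  have h2 : (fun ω => (0 : Ω → ℝ) ω • (0 : Ω → Fin d → ℝ) ω) = 0 := by
    funext ω
    simp
  rw [h2] at h1
  filter_upwards [h1] with ω hω
  simpa using hω

variable [IsProbabilityMeasure P]

/-- The approximate subgradients of the mean of the risk measure are induced by dual pairs. -/
theorem Fatou.exists_dual_subgradient (hFat : Fatou F P d T rho) (h : ScalarRM F P d T t rho)
    (hFil : FiltrationOK F P T) (hK : ConesOK K) (hKc : KCompat F P d T K t rho)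
    {X : Ω → Fin d → ℝ} (hX : X ∈ boundedMeasurable Ω (Fin d → ℝ)) {ε : ℝ} (hε : 0 < ε) :
    ∃ Qv mp, memWte1 F P d T K t Qv mp ∧ ∀ Y ∈ boundedMeasurable Ω (Fin d → ℝ),
      ∫ ω, dot (dualDensity F P t Qv mp ω) (X ω) ∂P + ∫ ω, rho X ω ∂P - ε ≤
        ∫ ω, dot (dualDensity F P t Qv mp ω) (Y ω) ∂P + ∫ ω, rho Y ω ∂P := by
  obtain ⟨i₀, hi₀⟩ := h.exists_zero_index hFil
  obtain ⟨v, hv, hv0, hv1, hvK, hvY⟩ := hFat.exists_subgradient h hFil hK hKc hi₀ hX hε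
  obtain ⟨Qv, mp, hW, hwv⟩ := exists_memWte1 (hFil.2.1 t) hv hv0 hi₀ hv1 hvK
  have hi : ∀ Y : Ω → Fin d → ℝ, ∫ ω, dot (dualDensity F P t Qv mp ω) (Y ω) ∂P =
      ∫ ω, dot (v ω) (Y ω) ∂P := fun Y => integral_congr_ae (by
    filter_upwards [hwv] with ω hω
    rw [hω])
  refine ⟨Qv, mp, hW, fun Y hY => ?_⟩
  rw [hi, hi]
  exact hvY Y hY

theorem integral_condExp_dot_neg (hFt : F t ≤ m0) {v Z : Ω → Fin d → ℝ} :
    ∫ ω, (P[fun ω => dot (v ω) (-Z ω)|F t]) ω ∂P = -∫ ω, dot (v ω) (Z ω) ∂P := by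
  rw [integral_condExp hFt, ← integral_neg]
  simp_rw [dot_neg_right]

/-- Some dual pair attains the risk measure up to an arbitrarily small mean error. -/
theorem Fatou.exists_dual_lower_bound (hFat : Fatou F P d T rho) (h : ScalarRM F P d T t rho)
    (hFil : FiltrationOK F P T) (hK : ConesOK K) (hKc : KCompat F P d T K t rho)
    {X : Ω → Fin d → ℝ} (hX : X ∈ boundedMeasurable Ω (Fin d → ℝ)) {ε : ℝ} (hε : 0 < ε) :
    ∃ Qv mp, memWte1 F P d T K t Qv mp ∧ ∀ a : Ω → EReal,
      IsEssSupSetE P {g | ∃ Z ∈ Acc F P d T rho, g = fun ω => ((∑ i : Fin d,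
        (e1 d i + mp ω i) * EQcond F P (Qv i) t (fun ω' => -Z ω' i) ω : ℝ) : EReal)} a →
      ∃ f : Ω → ℝ, Integrable f P ∧ f ≤ᵐ[P] rho X ∧
        ∫ ω, rho X ω ∂P - ε ≤ ∫ ω, f ω ∂P ∧
        ∀ᵐ ω ∂P, (f ω : EReal) ≤ -a ω - ((∑ i : Fin d, (e1 d i + mp ω i) *
          EQcond F P (Qv i) t (fun ω' => X ω' i) ω : ℝ) : EReal) := by
  have hFt := hFil.2.1 t
  obtain ⟨Qv, mp, hW, hY⟩ := hFat.exists_dual_subgradient h hFil hK hKc hX hε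
  refine ⟨Qv, mp, hW, fun a ha => ?_⟩
  set w := dualDensity F P t Qv mp
  have hw := hW.integrable_dualDensity
  obtain ⟨m, -, -, hm⟩ := h.exists_add_smul_e1_mem_Acc hFil
    (Submodule.zero_mem (boundedMeasurable Ω (Fin d → ℝ)))
  obtain ⟨g, hgi, hgS, hgc⟩ := exists_integrable_upper_bound_of_directed (P := P)
    (S := {g | ∃ Z ∈ Acc F P d T rho, g = P[fun ω => dot (w ω) (-Z ω)|F t]})
    (c := ε - ∫ ω, dot (w ω) (X ω) ∂P - ∫ ω, rho X ω ∂P)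
    ⟨_, _, hm, rfl⟩
    (by rintro _ ⟨Z, -, rfl⟩; exact integrable_condExp)
    (by
      rintro _ ⟨Z₁, hZ₁, rfl⟩ _ ⟨Z₂, hZ₂, rfl⟩
      obtain ⟨Z, hZ, h1, h2⟩ := h.directed_condExp_Acc hFil hw hZ₁ hZ₂
      exact ⟨_, ⟨Z, hZ, rfl⟩, h1, h2⟩)
    (by
      rintro _ ⟨Z, hZ, rfl⟩
      rw [integral_condExp_dot_neg hFt]
      linarith [hY Z (Acc.mem hFil hZ), Acc.integral_nonpos hZ])
  have hag : ∀ᵐ ω ∂P, a ω ≤ (g ω : EReal) := by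
    refine ha.2 _ ?_
    rintro _ ⟨Z, hZ, rfl⟩
    filter_upwards [hgS _ ⟨Z, hZ, rfl⟩,
      hW.sum_EQcond hFt (Submodule.neg_mem _ (Acc.mem hFil hZ))] with ω h1 h2
    exact EReal.coe_le_coe_iff.2 ((le_of_eq h2).trans h1)
  have hle : ∀ᵐ ω ∂P, ((-g ω - (P[fun ω => dot (w ω) (X ω)|F t]) ω : ℝ) : EReal) ≤
      -a ω - ((∑ i : Fin d, (e1 d i + mp ω i) *
          EQcond F P (Qv i) t (fun ω' => X ω' i) ω : ℝ) : EReal) := by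
    filter_upwards [hag, hW.sum_EQcond hFt hX] with ω h1 h2
    rw [h2, EReal.coe_sub, EReal.coe_neg]
    exact EReal.sub_le_sub (EReal.neg_le_neg_iff.2 h1) le_rfl
  refine ⟨_, hgi.neg.sub integrable_condExp, ?_, ?_, hle⟩
  · filter_upwards [hle, h.neg_alpha_sub_le hFil hW
      (fun Z hZ => ha.1 _ ⟨Z, hZ, rfl⟩) hX] with ω h1 h2
    exact EReal.coe_le_coe_iff.1 (h1.trans h2)
  · rw [integral_sub' hgi.neg integrable_condExp, integral_neg', integral_condExp hFt]
    linarith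

/-- In the coherent case near-optimal dual pairs have vanishing penalty. -/
theorem Fatou.exists_dual_lower_bound_of_coherent (hFat : Fatou F P d T rho)
    (h : ScalarRM F P d T t rho) (hcoh : CoherentRM F P d T t rho)
    (hFil : FiltrationOK F P T) (hK : ConesOK K) (hKc : KCompat F P d T K t rho)
    {X : Ω → Fin d → ℝ} (hX : X ∈ boundedMeasurable Ω (Fin d → ℝ)) {ε : ℝ} (hε : 0 < ε) :
    ∃ Qv mp, memWte1 F P d T K t Qv mp ∧
      (∀ Z ∈ Acc F P d T rho, ∀ᵐ ω ∂P, (∑ i : Fin d,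
        (e1 d i + mp ω i) * EQcond F P (Qv i) t (fun ω' => -Z ω' i) ω) ≤ 0) ∧
      ∫ ω, rho X ω ∂P - ε ≤ ∫ ω, -(∑ i : Fin d, (e1 d i + mp ω i) *
          EQcond F P (Qv i) t (fun ω' => X ω' i) ω) ∂P := by
  have hFt := hFil.2.1 t
  obtain ⟨Qv, mp, hW, hY⟩ := hFat.exists_dual_subgradient h hFil hK hKc hX hε
  refine ⟨Qv, mp, hW, ?_⟩
  set w := dualDensity F P t Qv mp
  have hw := hW.integrable_dualDensity
  have h0 : (0 : Ω → Fin d → ℝ) ∈ boundedMeasurable Ω (Fin d → ℝ) := Submodule.zero_mem _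
  have hz := hcoh.zero_ae hFil
  have hz0 : (0 : Ω → Fin d → ℝ) ∈ Acc F P d T rho :=
    ⟨(mem_LinfD_iff hFil.2.2.1).2 h0, hz.le⟩
  have hdz : ∀ ω, dot (w ω) 0 = 0 := fun ω => by simp [dot]
  have hnn : ∀ Y ∈ boundedMeasurable Ω (Fin d → ℝ),
      0 ≤ ∫ ω, dot (w ω) (Y ω) ∂P + ∫ ω, rho Y ω ∂P := fun Y hYB => by
    refine nonneg_of_forall_nat_mul_le (a := 0)
      (δ := ∫ ω, dot (w ω) (X ω) ∂P + ∫ ω, rho X ω ∂P - ε) fun n => ?_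
    have h1 := hY _ (Submodule.smul_mem _ (n : ℝ) hYB)
    have h2 : ∫ ω, rho ((n : ℝ) • Y) ω ∂P = n * ∫ ω, rho Y ω ∂P := by
      rw [← integral_const_mul]
      exact integral_congr_ae (hcoh Y ((mem_LinfD_iff hFil.2.2.1).2 hYB) (fun _ => (n : ℝ))
        (const_mem_Linf _) fun _ => n.cast_nonneg)
    have h3 : ∫ ω, dot (w ω) (((n : ℝ) • Y) ω) ∂P = n * ∫ ω, dot (w ω) (Y ω) ∂P := by
      rw [← integral_const_mul]
      simp_rw [Pi.smul_apply, dot_smul_right]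
    rw [h2, h3] at h1
    linarith
  refine ⟨fun Z hZ => ?_, ?_⟩
  · set E := P[fun ω => dot (w ω) (-Z ω)|F t]
    have hE : ∀ᵐ ω ∂P, E ω ≤ 0 := by
      refine ae_nonpos_of_integral_posPart_le integrable_condExp fun δ hδ => ?_
      obtain ⟨Z', hZ', h1, h2⟩ := h.directed_condExp_Acc hFil hw hZ hz0
      have h3 : (fun ω => dot (w ω) (-(0 : Ω → Fin d → ℝ) ω)) = 0 := by
        funext ω
        simp [hdz]
      rw [h3, condExp_zero] at h2
      have h4 : ∫ ω, max (E ω) 0 ∂P ≤ ∫ ω, (P[fun ω => dot (w ω) (-Z' ω)|F t]) ω ∂P :=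
        integral_mono_ae integrable_condExp.pos_part integrable_condExp (by
          filter_upwards [h1, h2] with ω a1 a2
          exact max_le a1 a2)
      rw [integral_condExp_dot_neg hFt] at h4
      linarith [hnn Z' (Acc.mem hFil hZ'), Acc.integral_nonpos hZ']
    filter_upwards [hE, hW.sum_EQcond hFt (Submodule.neg_mem _ (Acc.mem hFil hZ))] with ω a1 a2
    exact (le_of_eq a2).trans a1
  · have h1 := hY 0 h0
    rw [integral_congr_ae hz] at h1
    simp only [Pi.zero_apply, hdz, integral_zero] at h1
    rw [integral_neg, integral_congr_ae (hW.sum_EQcond hFt hX), integral_condExp hFt]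
    linarith

end Existence

theorem abs_dot_le {d : ℕ} (x y : Fin d → ℝ) : |dot x y| ≤ (∑ i, |x i|) * ‖y‖ := by
  rw [dot, Finset.sum_mul]
  refine (Finset.abs_sum_le_sum_abs _ _).trans (Finset.sum_le_sum fun i _ => ?_)
  rw [abs_mul]
  exact mul_le_mul_of_nonneg_left (norm_le_pi_norm y i) (abs_nonneg _)

theorem continuous_dot {d : ℕ} (x : Fin d → ℝ) : Continuous (dot x) := by
  unfold dot
  fun_prop

/-- Lower bounds in the extended reals pass from a convergent sequence to its limit inferior. -/
theorem neg_sub_le_liminf {a : EReal} {x y : ℕ → ℝ} {x' R : ℝ}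
    (hx : Tendsto x atTop (nhds x')) (hR : ∀ n, |y n| ≤ R)
    (h : ∀ n, -a - (x n : EReal) ≤ (y n : EReal)) :
    -a - (x' : EReal) ≤ (liminf y atTop : ℝ) := by
  induction a with
  | bot =>
    have h0 := h 0
    simp at h0
  | top => simp
  | coe a =>
    have h' : ∀ n, -a - x n ≤ y n := fun n => by
      have := h n
      rwa [← EReal.coe_neg, ← EReal.coe_sub, EReal.coe_le_coe_iff] at this
    rw [← EReal.coe_neg, ← EReal.coe_sub, EReal.coe_le_coe_iff]
    have ht : Tendsto (fun n => -a - x n) atTop (nhds (-a - x')) := hx.const_sub _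
    rw [← ht.liminf_eq]
    refine liminf_le_liminf (Eventually.of_forall h') ht.isBoundedUnder_ge ?_
    exact (isBoundedUnder_of ⟨R, fun n => (abs_le.1 (hR n)).2⟩ :
      IsBoundedUnder (· ≤ ·) atTop y).isCoboundedUnder_ge

section Sufficiency
variable [m0 : MeasurableSpace Ω] {P : Measure Ω} {F : ℕ → MeasurableSpace Ω} {d T t : ℕ}
  {rho : (Ω → Fin d → ℝ) → Ω → ℝ} {K : ℕ → Ω → Set (Fin d → ℝ)} {Qv : Fin d → Measure Ω}
  {mp : Ω → Fin d → ℝ} [IsProbabilityMeasure P]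

theorem memWte1.tendsto_sum_EQcond (hFt : F t ≤ m0) (hW : memWte1 F P d T K t Qv mp)
    {X : Ω → Fin d → ℝ} (hX : X ∈ boundedMeasurable Ω (Fin d → ℝ)) {U : ℕ → Ω → Fin d → ℝ}
    (hU : ∀ n, U n ∈ boundedMeasurable Ω (Fin d → ℝ)) {C : ℝ} (hUC : ∀ n ω, ‖U n ω‖ ≤ C)
    (hlim : ∀ᵐ ω ∂P, Tendsto (fun n => U n ω) atTop (nhds (X ω))) :
    ∀ᵐ ω ∂P, Tendsto (fun n => ∑ i : Fin d, (e1 d i + mp ω i) *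
        EQcond F P (Qv i) t (fun ω' => U n ω' i) ω) atTop
      (nhds (∑ i : Fin d, (e1 d i + mp ω i) * EQcond F P (Qv i) t (fun ω' => X ω' i) ω)) := by
  have hw := hW.integrable_dualDensity
  obtain ⟨R, hR⟩ := hX.2
  have hbd : ∀ n ω, |dot (dualDensity F P t Qv mp ω) (U n ω) -
      dot (dualDensity F P t Qv mp ω) (X ω)| ≤
        (∑ i, |dualDensity F P t Qv mp ω i|) * (C + R) := fun n ω => by
    rw [← dot_sub_right]
    exact (abs_dot_le _ _).trans (mul_le_mul_of_nonneg_left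
      ((norm_sub_le _ _).trans (add_le_add (hUC n ω) (hR ω)))
      (Finset.sum_nonneg fun i _ => abs_nonneg _))
  filter_upwards [tendsto_condExp_of_dominated hFt (fun n => integrable_dot hw (hU n))
    (integrable_dot hw hX)
    ((integrable_finsetSum Finset.univ fun i _ => (hw i).abs).mul_const (C + R))
    (fun n => Eventually.of_forall (hbd n))
    (hlim.mono fun ω hω => ((continuous_dot _).tendsto _).comp hω),
    hW.sum_EQcond hFt hX, ae_all_iff.2 fun n => hW.sum_EQcond hFt (hU n)] with ω h1 h2 h3
  rw [h2]
  exact h1.congr fun n => (h3 n).symm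

/-- A lower bound given by a dual pair is inherited by the limit inferior of the risks along
bounded almost surely convergent sequences. -/
theorem ScalarRM.neg_sub_le_liminf (h : ScalarRM F P d T t rho) (hFil : FiltrationOK F P T)
    (hW : memWte1 F P d T K t Qv mp) {a : Ω → EReal}
    (ha : ∀ X ∈ LinfD F d T, ∀ᵐ ω ∂P, -a ω - ((∑ i : Fin d, (e1 d i + mp ω i) *
      EQcond F P (Qv i) t (fun ω' => X ω' i) ω : ℝ) : EReal) ≤ (rho X ω : EReal))
    {X : Ω → Fin d → ℝ} (hX : X ∈ LinfD F d T) {U : ℕ → Ω → Fin d → ℝ}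
    (hU : ∀ n, U n ∈ LinfD F d T) {C : ℝ} (hUC : ∀ n ω i, |U n ω i| ≤ C)
    (hlim : ∀ᵐ ω ∂P, Tendsto (fun n => U n ω) atTop (nhds (X ω))) :
    ∀ᵐ ω ∂P, -a ω - ((∑ i : Fin d, (e1 d i + mp ω i) *
      EQcond F P (Qv i) t (fun ω' => X ω' i) ω : ℝ) : EReal) ≤
        (atTop.liminf fun n => rho (U n) ω : ℝ) := by
  have hB : ∀ {X : Ω → Fin d → ℝ}, X ∈ LinfD F d T → X ∈ boundedMeasurable Ω (Fin d → ℝ) :=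
    (mem_LinfD_iff hFil.2.2.1).1
  have hUC' : ∀ n ω, ‖U n ω‖ ≤ max C 0 := fun n ω =>
    (pi_norm_le_iff_of_nonneg (le_max_right _ _)).2 fun i => (hUC n ω i).trans (le_max_left _ _)
  obtain ⟨R, hR⟩ := h.exists_bound hFil (max C 0)
  filter_upwards [hW.tendsto_sum_EQcond (hFil.2.1 t) (hB hX) (fun n => hB (hU n)) hUC' hlim,
    ae_all_iff.2 fun n => hR _ (hB (hU n)) (hUC' n), ae_all_iff.2 fun n => ha _ (hU n)]
    with ω h1 h2 h3
  exact RiskPaper.neg_sub_le_liminf h1 h2 h3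

end Sufficiency

theorem EQcond_zero [MeasurableSpace Ω] {F : ℕ → MeasurableSpace Ω} {P Q : Measure Ω}
    {t : ℕ} : EQcond F P Q t (fun _ => 0) = 0 := by
  simp only [EQcond, mul_zero]
  exact condExp_zero

/-- A penalty without positive competitors vanishes for a coherent risk measure. -/
theorem CoherentRM.alpha_ae_eq_zero [m0 : MeasurableSpace Ω] {P : Measure Ω}
    {F : ℕ → MeasurableSpace Ω} {d T t : ℕ} {rho : (Ω → Fin d → ℝ) → Ω → ℝ}
    {Qv : Fin d → Measure Ω} {mp : Ω → Fin d → ℝ} {a : Ω → EReal}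
    (hcoh : CoherentRM F P d T t rho) (hFil : FiltrationOK F P T)
    (ha : IsEssSupSetE P {g | ∃ Z ∈ Acc F P d T rho, g = fun ω => ((∑ i : Fin d,
      (e1 d i + mp ω i) * EQcond F P (Qv i) t (fun ω' => -Z ω' i) ω : ℝ) : EReal)} a)
    (hneg : ∀ Z ∈ Acc F P d T rho, ∀ᵐ ω ∂P, (∑ i : Fin d,
      (e1 d i + mp ω i) * EQcond F P (Qv i) t (fun ω' => -Z ω' i) ω) ≤ 0) :
    a =ᵐ[P] fun _ => 0 := by
  have h0 := ha.1 _ ⟨0, ⟨(mem_LinfD_iff hFil.2.2.1).2 (Submodule.zero_mem _),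
    (hcoh.zero_ae hFil).le⟩, rfl⟩
  have h1 := ha.2 (fun _ => 0) (by
    rintro _ ⟨Z, hZ, rfl⟩
    filter_upwards [hneg Z hZ] with ω hω
    exact EReal.coe_nonpos.2 hω)
  filter_upwards [h0, h1] with ω a1 a2
  refine le_antisymm a2 ?_
  simpa [EQcond_zero] using a1

/-- Proposition 4.2.  `ρ_t` satisfies the Fatou property iff it has the dual
representation `ρ_t(X) = esssup_{(Q,m_⊥) ∈ 𝒲_t(e₁)} (−α_t(Q,m_⊥) − (e₁+m_⊥)^⊤ E^Q[X|F_t])`;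
in the coherent case this reduces to the representation over
`𝒲_t^ρ(e₁) = {(Q,m_⊥) : α_t(Q,m_⊥) = 0 a.s.}`. -/
theorem statement2 [MeasurableSpace Ω] (F : ℕ → MeasurableSpace Ω) (P : Measure Ω)
    [IsProbabilityMeasure P] (d T t : ℕ) (ht : t ≤ T) (K : ℕ → Ω → Set (Fin d → ℝ))
    (hFil : FiltrationOK F P T) (hK : ConesOK K) (hKbar : FrictionAssumption P T K)
    (rho : (Ω → Fin d → ℝ) → Ω → ℝ)
    (hrho : ScalarRM F P d T t rho) (hKcomp : KCompat F P d T K t rho)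
    -- `alpha Qv mp` is a version of the penalty
    -- `α_t(Q,m_⊥) = esssup_{Z ∈ A_t} (e₁+m_⊥)^⊤ E^Q[−Z | F_t]`:
    (alpha : (Fin d → Measure Ω) → (Ω → Fin d → ℝ) → Ω → EReal)
    (halpha : ∀ Qv mp, memWte1 F P d T K t Qv mp →
      IsEssSupSetE P
        {g | ∃ Z ∈ Acc F P d T rho, g = fun ω =>
          ((∑ i : Fin d, (e1 d i + mp ω i) *
            EQcond F P (Qv i) t (fun ω' => -Z ω' i) ω : ℝ) : EReal)}
        (alpha Qv mp)) :
    -- convex case: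
    (Fatou F P d T rho ↔
      ∀ X ∈ LinfD F d T,
        IsEssSupSetE P
          {g | ∃ Qv mp, memWte1 F P d T K t Qv mp ∧ g = fun ω =>
            -alpha Qv mp ω -
              ((∑ i : Fin d, (e1 d i + mp ω i) *
                EQcond F P (Qv i) t (fun ω' => X ω' i) ω : ℝ) : EReal)}
          fun ω => ((rho X ω : ℝ) : EReal)) ∧
    -- coherent case:
    (CoherentRM F P d T t rho →
      (Fatou F P d T rho ↔
        ∀ X ∈ LinfD F d T,
          IsEssSupSetE P
            {g | ∃ Qv mp, memWte1 F P d T K t Qv mp ∧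
              (alpha Qv mp =ᵐ[P] fun _ => (0 : EReal)) ∧ g = fun ω =>
              ((-(∑ i : Fin d, (e1 d i + mp ω i) *
                EQcond F P (Qv i) t (fun ω' => X ω' i) ω) : ℝ) : EReal)}
            fun ω => ((rho X ω : ℝ) : EReal))) := by
  have hB : ∀ {X : Ω → Fin d → ℝ}, X ∈ LinfD F d T → X ∈ boundedMeasurable Ω (Fin d → ℝ) :=
    (mem_LinfD_iff hFil.2.2.1).1
  refine ⟨⟨fun hFat X hX => ⟨?_, fun b hb => ?_⟩, fun hrep X hX U hU ⟨C, hUC⟩ hlim => ?_⟩,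
    fun hcoh => ⟨fun hFat X hX => ⟨?_, fun b hb => ?_⟩, fun hrep X hX U hU ⟨C, hUC⟩ hlim => ?_⟩⟩
  · rintro _ ⟨Qv, mp, hW, rfl⟩
    exact hrho.neg_alpha_sub_le hFil hW
      (fun Z hZ => (halpha Qv mp hW).1 _ ⟨Z, hZ, rfl⟩) (hB hX)
  · refine ae_le_of_forall_integral_ge (hrho.integrable hFil (hB hX)) fun ε hε => ?_
    obtain ⟨Qv, mp, hW, hex⟩ := hFat.exists_dual_lower_bound hrho hFil hK hKcomp (hB hX) hε
    obtain ⟨f, hfi, hfr, hfε, hfa⟩ := hex _ (halpha Qv mp hW)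
    refine ⟨f, hfi, hfr, hfε, ?_⟩
    filter_upwards [hfa, hb _ ⟨Qv, mp, hW, rfl⟩] with ω h1 h2
    exact h1.trans h2
  · have h1 := (hrep X hX).2 (fun ω => (atTop.liminf fun n => rho (U n) ω : ℝ)) (by
      rintro _ ⟨Qv, mp, hW, rfl⟩
      exact hrho.neg_sub_le_liminf hFil hW
        (fun Y hY => (hrep Y hY).1 _ ⟨Qv, mp, hW, rfl⟩) hX hU hUC hlim)
    filter_upwards [h1] with ω hω
    exact EReal.coe_le_coe_iff.1 hω
  · rintro _ ⟨Qv, mp, hW, hα, rfl⟩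
    filter_upwards [hα, hrho.neg_alpha_sub_le hFil hW
      (fun Z hZ => (halpha Qv mp hW).1 _ ⟨Z, hZ, rfl⟩) (hB hX)] with ω h1 h2
    rwa [h1, neg_zero, zero_sub, ← EReal.coe_neg] at h2
  · refine ae_le_of_forall_integral_ge (hrho.integrable hFil (hB hX)) fun ε hε => ?_
    obtain ⟨Qv, mp, hW, hneg, hε'⟩ :=
      hFat.exists_dual_lower_bound_of_coherent hrho hcoh hFil hK hKcomp (hB hX) hε
    have hα := hcoh.alpha_ae_eq_zero hFil (halpha Qv mp hW) hneg
    refine ⟨_, ?_, ?_, hε', hb _ ⟨Qv, mp, hW, hα, rfl⟩⟩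
    · exact (integrable_condExp.congr (hW.sum_EQcond (hFil.2.1 t) (hB hX)).symm).neg
    · filter_upwards [hα, hrho.neg_alpha_sub_le hFil hW
        (fun Z hZ => (halpha Qv mp hW).1 _ ⟨Z, hZ, rfl⟩) (hB hX)] with ω h1 h2
      rwa [h1, neg_zero, zero_sub, ← EReal.coe_neg, EReal.coe_le_coe_iff] at h2
  · have h1 := (hrep X hX).2 (fun ω => (atTop.liminf fun n => rho (U n) ω : ℝ)) (by
      rintro _ ⟨Qv, mp, hW, hα, rfl⟩
      have := hrho.neg_sub_le_liminf hFil hW (a := fun _ => 0) (fun Y hY => by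
        filter_upwards [(hrep Y hY).1 _ ⟨Qv, mp, hW, hα, rfl⟩] with ω hω
        rwa [neg_zero, zero_sub, ← EReal.coe_neg]) hX hU hUC hlim
      filter_upwards [this] with ω hω
      rwa [neg_zero, zero_sub, ← EReal.coe_neg] at hω)
    filter_upwards [h1] with ω hω
    exact EReal.coe_le_coe_iff.1 hω

end RiskPaper
end
end
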